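/- Let k be a field and let f : S' → S be a proper morphism between integral regular separated schemes of finite type over k, each of Krull dimension 2, which restricts to an isomorphism over a dense open subscheme of S (i.e., f is a proper birational morphism of regular surfaces). Then for every point s of S, the scheme-theoretic fiber S'_s = S' ×_S Spec κ(s) is an A¹-chain connected κ(s)-scheme: for every field extension M of κ(s), any two M-points of S'_s are A¹-equivalent. -/

import Mathlib

open AlgebraicGeometry CategoryTheory CategoryTheory.Limits

noncomputable section

/-- The morphism `Spec S ⟶ Spec R` induced by a ring homomorphism `R →+* S`. -/
def specMapOf {R S : Type} [CommRing R] [CommRing S] (f : R →+* S) :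
    Spec (CommRingCat.of S) ⟶ Spec (CommRingCat.of R) :=
  Spec.map (CommRingCat.ofHom f)

/-- Two `L`-points `x₀, x₁` of an `F`-scheme `(Z, sZ)` (where the `F`-algebra structure of `L`
is recorded by the ring homomorphism `φ : F →+* L`) are *elementarily `𝔸¹`-equivalent* if there
is an `F`-morphism `f : 𝔸¹_L = Spec L[T] ⟶ Z` with `f ∘ i₀ = x₀` and `f ∘ i₁ = x₁`, where
`i₀, i₁ : Spec L ⟶ 𝔸¹_L` are the sections induced by evaluation of polynomials at `0` resp. `1`. -/
def ElemA1Equiv (F : Type) [Field F] (L : Type) [Field L] (φ : F →+* L)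
    (Z : Scheme) (sZ : Z ⟶ Spec (CommRingCat.of F))
    (x₀ x₁ : Spec (CommRingCat.of L) ⟶ Z) : Prop :=
  ∃ f : Spec (CommRingCat.of (Polynomial L)) ⟶ Z,
    f ≫ sZ = specMapOf ((Polynomial.C : L →+* Polynomial L).comp φ) ∧
    specMapOf (Polynomial.evalRingHom (0 : L)) ≫ f = x₀ ∧
    specMapOf (Polynomial.evalRingHom (1 : L)) ≫ f = x₁

/-- `𝔸¹`-equivalence of `L`-points: the equivalence relation generated by elementary
`𝔸¹`-equivalence. -/
def A1Equiv (F : Type) [Field F] (L : Type) [Field L] (φ : F →+* L)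
    (Z : Scheme) (sZ : Z ⟶ Spec (CommRingCat.of F))
    (x₀ x₁ : Spec (CommRingCat.of L) ⟶ Z) : Prop :=
  Relation.EqvGen (ElemA1Equiv F L φ Z sZ) x₀ x₁

/-- A scheme is *regular* if all of its local rings are regular local rings, i.e. Noetherian
local rings whose maximal ideal is generated by (Krull dimension)-many elements. -/
def IsRegularScheme (X : Scheme) : Prop :=
  ∀ x : X, IsNoetherianRing (X.presheaf.stalk x) ∧
    ∃ (n : ℕ) (g : Fin n → X.presheaf.stalk x),
      Ideal.span (Set.range g) = IsLocalRing.maximalIdeal (X.presheaf.stalk x) ∧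
      (n : WithBot ℕ∞) = ringKrullDim (X.presheaf.stalk x)

section Gauss

open IsLocalRing Polynomial

variable {K : Type*} [Field K]

/-- A normal noetherian local subring with fraction field `K` whose maximal ideal is generated
by two elements. -/
structure LocalSubring.IsSurfaceLike (A : LocalSubring K) : Prop where
  noeth : IsNoetherianRing A.toSubring
  closed : ∀ c : K, _root_.IsIntegral A.toSubring c → c ∈ A.toSubring
  gen : ∃ x y : A.toSubring, maximalIdeal A.toSubring = Ideal.span {x, y}
  frac : ∀ c : K, ∃ a b : A.toSubring, b ≠ 0 ∧ c * b = a

theorem LocalSubring.coeff_mem_maximalIdeal_of_aeval_eq_zero (A : LocalSubring K)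
    (hA : ∀ c : K, _root_.IsIntegral A.toSubring c → c ∈ A.toSubring) {t : K}
    (ht : t ∉ A.toSubring) (ht' : t⁻¹ ∉ A.toSubring) (f : A.toSubring[X])
    (hf : aeval t f = 0) (i : ℕ) : f.coeff i ∈ maximalIdeal A.toSubring := by
  suffices H : ∀ (n : ℕ) (f : A.toSubring[X]), f.natDegree ≤ n → aeval t f = 0 →
      ∀ i, f.coeff i ∈ maximalIdeal A.toSubring from H _ f le_rfl hf i
  clear hf i f
  intro n
  induction n with
  | zero =>
    intro f hn hf i
    rw [eq_C_of_natDegree_le_zero hn] at hf ⊢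
    rw [aeval_C] at hf
    have : f.coeff 0 = 0 := Subtype.ext hf
    simp [this]
  | succ n ih =>
    intro f hn hf
    set a := f.coeff (n + 1) with ha
    have ht_mem : (a : K) * t ∈ A.toSubring := by
      by_cases h0 : f.natDegree = n + 1
      · have hl : a = f.leadingCoeff := by rw [ha, leadingCoeff, h0]
        have := isIntegral_leadingCoeff_smul f t hf
        rw [← hl] at this
        exact hA _ this
      · have : a = 0 := coeff_eq_zero_of_natDegree_lt (lt_of_le_of_ne hn h0)
        simp [this]
    set b : A.toSubring := ⟨a * t, ht_mem⟩ with hb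
    -- lower the degree by absorbing the leading term
    set g : A.toSubring[X] := f - C a * X ^ (n + 1) + C b * X ^ n with hg
    have hgt : aeval t g = 0 := by
      have h1 : algebraMap A.toSubring K a = (a : K) := rfl
      have h2 : algebraMap A.toSubring K b = (a : K) * t := rfl
      simp only [hg, map_add, map_sub, map_mul, map_pow, aeval_C, aeval_X, hf, h1, h2]
      ring
    have hgd : g.natDegree ≤ n := by
      rw [natDegree_le_iff_coeff_eq_zero]
      intro N hN
      simp only [hg, coeff_add, coeff_sub, coeff_C_mul, coeff_X_pow]
      rcases eq_or_ne N (n + 1) with rfl | h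
      · simp [ha]
      · have : n + 1 < N := by omega
        have : f.coeff N = 0 := coeff_eq_zero_of_natDegree_lt (by omega)
        simp [this, h, show N ≠ n by omega]
    have hgm := ih g hgd hgt
    have hlow : ∀ i, i ≠ n → i ≠ n + 1 → f.coeff i ∈ maximalIdeal A.toSubring := by
      intro i h1 h2
      have := hgm i
      simpa [hg, coeff_X_pow, h1, h2, coeff_C] using this
    have hn' : f.coeff n + b ∈ maximalIdeal A.toSubring := by
      have := hgm n
      simpa [hg, coeff_X_pow] using this
    have ham : a ∈ maximalIdeal A.toSubring := by
      by_contra hu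
      have hu : IsUnit a := by simpa using hu
      obtain ⟨c, hc⟩ := isUnit_iff_exists_inv.mp hu
      apply ht
      have hc' : (a : K) * c = 1 := congrArg Subtype.val hc
      have : t = c * b := by
        change t = c * (a * t)
        linear_combination (-t) * hc'
      rw [this]
      exact (c * b).2
    have hbm : b ∈ maximalIdeal A.toSubring := by
      by_contra hu
      have hu : IsUnit b := by simpa using hu
      obtain ⟨c, hc⟩ := isUnit_iff_exists_inv.mp hu
      apply ht'
      have hc' : (a : K) * t * c = 1 := congrArg Subtype.val hc
      have ht0 : t ≠ 0 := by rintro rfl; simp at hc'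
      have : t⁻¹ = a * c := by
        field_simp
        linear_combination -hc'
      rw [this]
      exact (a * c).2
    intro i
    by_cases h1 : i = n
    · subst h1
      simpa using sub_mem hn' hbm
    by_cases h2 : i = n + 1
    · subst h2; exact ham
    exact hlow i h1 h2

/-- The localization of the image of `f` at the kernel of `g`, as a local subring of `K`, together
with the induced homomorphism. -/
theorem LocalSubring.exists_localization {P F : Type*} [CommRing P] [Field F] (f : P →+* K)
    (g : P →+* F) (h : ∀ p, f p = 0 → g p = 0) :
    ∃ (L : LocalSubring K) (χ : L.toSubring →+* F), IsLocalHom χ ∧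
      (∀ p, ∃ hp : f p ∈ L.toSubring, χ ⟨f p, hp⟩ = g p) ∧
      (∀ c ∈ L.toSubring, ∃ p q, g q ≠ 0 ∧ c * f q = f p) ∧
      (IsNoetherianRing P → IsNoetherianRing L.toSubring) := by
  have hk : RingHom.ker f.rangeRestrict ≤ RingHom.ker g := by
    intro p hp
    exact h p (congrArg Subtype.val hp)
  let g' : f.range →+* F := RingHom.liftOfSurjective f.rangeRestrict f.rangeRestrict_surjective
    ⟨g, hk⟩
  have hg' : ∀ p, g' (f.rangeRestrict p) = g p := fun p ↦
    RingHom.liftOfRightInverse_comp_apply _ _ _ ⟨g, hk⟩ p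
  let I : Ideal f.range := RingHom.ker g'
  have : I.IsPrime := RingHom.ker_isPrime g'
  let L := LocalSubring.ofPrime f.range I
  have hu : ∀ y : I.primeCompl, IsUnit (g' y) := fun y ↦
    isUnit_iff_ne_zero.mpr fun h0 ↦ y.2 h0
  let χ : L.toSubring →+* F := IsLocalization.lift (M := I.primeCompl) hu
  have hχ : ∀ b : f.range, χ (algebraMap f.range L.toSubring b) = g' b :=
    fun b ↦ IsLocalization.lift_eq hu b
  have key : ∀ c : L.toSubring, ∃ p q, g q ≠ 0 ∧ (c : K) * f q = f p ∧ χ c * g q = g p := by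
    intro c
    obtain ⟨⟨a, s⟩, hs⟩ := IsLocalization.surj I.primeCompl c
    obtain ⟨p, hp⟩ := f.rangeRestrict_surjective a
    obtain ⟨q, hq⟩ := f.rangeRestrict_surjective s.1
    have hs' := congrArg χ hs
    refine ⟨p, q, ?_, ?_, ?_⟩
    · intro h0
      exact s.2 (show g' s.1 = 0 by rw [← hq, hg', h0])
    · have := congrArg Subtype.val hs
      have e1 : f q = (s.1 : K) := congrArg Subtype.val hq
      have e2 : f p = (a : K) := congrArg Subtype.val hp
      rw [e1, e2]
      exact this
    · simp only [map_mul, hχ] at hs'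
      rw [← hq, ← hp, hg', hg'] at hs'
      exact hs'
  have hmem : ∀ p, f p ∈ L.toSubring := fun p ↦ LocalSubring.le_ofPrime _ _ ⟨p, rfl⟩
  have hval : ∀ p, χ ⟨f p, hmem p⟩ = g p := fun p ↦
    (hχ (f.rangeRestrict p)).trans (hg' p)
  refine ⟨L, χ, ⟨?_⟩, fun p ↦ ⟨hmem p, hval p⟩, ?_, ?_⟩
  · intro c hc
    obtain ⟨p, q, hq, h1, h2⟩ := key c
    have hp : g p ≠ 0 := by
      rw [← h2]; exact mul_ne_zero hc.ne_zero hq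
    -- the inverse of `c`
    have hpu : IsUnit (⟨f p, hmem p⟩ : L.toSubring) :=
      IsLocalization.map_units (M := I.primeCompl) L.toSubring
        ⟨f.rangeRestrict p, fun h0 ↦ hp ((hg' p).symm.trans h0)⟩
    have : c * ⟨f q, hmem q⟩ = ⟨f p, hmem p⟩ := Subtype.ext h1
    rw [← this] at hpu
    exact isUnit_of_mul_isUnit_left hpu
  · intro c hc
    obtain ⟨p, q, hq, h1, -⟩ := key ⟨c, hc⟩
    exact ⟨p, q, hq, h1⟩
  · intro hP
    have : IsNoetherianRing f.range := isNoetherianRing_range f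
    exact IsLocalization.isNoetherianRing I.primeCompl _ inferInstance

theorem LocalSubring.isUnit_mk_iff {A : LocalSubring K} {a : K} (ha : a ∈ A.toSubring) :
    IsUnit (⟨a, ha⟩ : A.toSubring) ↔ a ≠ 0 ∧ a⁻¹ ∈ A.toSubring := by
  constructor
  · intro h
    obtain ⟨⟨c, hc⟩, h1⟩ := isUnit_iff_exists_inv.mp h
    have h2 : a * c = 1 := congrArg Subtype.val h1
    refine ⟨left_ne_zero_of_mul_eq_one h2, ?_⟩
    rwa [inv_eq_of_mul_eq_one_right h2]
  · rintro ⟨h0, h1⟩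
    exact isUnit_iff_exists_inv.mpr ⟨⟨a⁻¹, h1⟩, Subtype.ext (mul_inv_cancel₀ h0)⟩

theorem LocalSubring.mem_maximalIdeal_iff {A : LocalSubring K} (a : A.toSubring) :
    a ∈ maximalIdeal A.toSubring ↔ ((a : K) ≠ 0 → (a : K)⁻¹ ∉ A.toSubring) := by
  rw [mem_maximalIdeal, mem_nonunits_iff, ← Subtype.coe_eta a a.2, isUnit_mk_iff]
  simp

theorem LocalSubring.le_iff_inv {A B : LocalSubring K} :
    A ≤ B ↔ A.toSubring ≤ B.toSubring ∧
      ∀ a ∈ A.toSubring, a⁻¹ ∈ B.toSubring → a⁻¹ ∈ A.toSubring := by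
  constructor
  · rintro ⟨h, h'⟩
    refine ⟨h, fun a ha hb ↦ ?_⟩
    rcases eq_or_ne a 0 with rfl | h0
    · simp
    · exact ((isUnit_mk_iff ha).mp (h'.1 ⟨a, ha⟩ ((isUnit_mk_iff (h ha)).mpr ⟨h0, hb⟩))).2
  · rintro ⟨h, h'⟩
    refine ⟨h, ⟨fun ⟨a, ha⟩ hu ↦ ?_⟩⟩
    obtain ⟨h0, h1⟩ := (isUnit_mk_iff (h ha)).mp hu
    exact (isUnit_mk_iff ha).mpr ⟨h0, h' a ha h1⟩

/-- `L` is the Gauss extension of `A` to `A[t]`: the localization of `A[t]` at the extension of the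
maximal ideal of `A`. -/
structure LocalSubring.IsGauss (A L : LocalSubring K) (t : K) : Prop where
  exists_eq : ∀ c ∈ L.toSubring, ∃ p q : A.toSubring[X],
    (¬ ∀ i, q.coeff i ∈ maximalIdeal A.toSubring) ∧ c * aeval t q = aeval t p
  mem : ∀ p : A.toSubring[X], aeval t p ∈ L.toSubring
  ne_zero : ∀ p : A.toSubring[X], (¬ ∀ i, p.coeff i ∈ maximalIdeal A.toSubring) → aeval t p ≠ 0
  inv_mem : ∀ p : A.toSubring[X], (¬ ∀ i, p.coeff i ∈ maximalIdeal A.toSubring) →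
    (aeval t p)⁻¹ ∈ L.toSubring
  inv_notMem : ∀ p : A.toSubring[X], (∀ i, p.coeff i ∈ maximalIdeal A.toSubring) →
    aeval t p ≠ 0 → (aeval t p)⁻¹ ∉ L.toSubring

theorem coeff_mem_maximalIdeal_iff {A : Type*} [CommRing A] [IsLocalRing A] (p : A[X]) :
    (∀ i, p.coeff i ∈ maximalIdeal A) ↔ p.map (residue A) = 0 := by
  simp [Polynomial.ext_iff, residue_eq_zero_iff]

theorem LocalSubring.exists_isGauss (A : LocalSubring K)
    (hA : ∀ c : K, _root_.IsIntegral A.toSubring c → c ∈ A.toSubring) {t : K}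
    (ht : t ∉ A.toSubring) (ht' : t⁻¹ ∉ A.toSubring) {F : Type*} [Field F]
    (g : A.toSubring[X] →+* F)
    (hg : ∀ p, g p = 0 ↔ ∀ i, p.coeff i ∈ maximalIdeal A.toSubring) :
    ∃ (L : LocalSubring K) (χ : L.toSubring →+* F), A.IsGauss L t ∧ IsLocalHom χ ∧
      ∀ p, ∃ hp : aeval t p ∈ L.toSubring, χ ⟨aeval t p, hp⟩ = g p := by
  obtain ⟨L, χ, h1, h2, h3, -⟩ := exists_localization (aeval t : A.toSubring[X] →ₐ[_] K).toRingHom g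
    fun p hp ↦ (hg p).mpr (A.coeff_mem_maximalIdeal_of_aeval_eq_zero hA ht ht' p hp)
  refine ⟨L, χ, ⟨?_, fun p ↦ (h2 p).1, ?_, ?_, ?_⟩, h1, h2⟩
  · intro c hc
    obtain ⟨p, q, hq, h⟩ := h3 c hc
    exact ⟨p, q, fun h0 ↦ hq ((hg q).mpr h0), h⟩
  · intro p hp h0
    exact hp (A.coeff_mem_maximalIdeal_of_aeval_eq_zero hA ht ht' p h0)
  · intro p hp
    obtain ⟨hp1, hp2⟩ := h2 p
    have : IsUnit (χ ⟨_, hp1⟩) := by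
      rw [hp2, isUnit_iff_ne_zero]; exact fun h0 ↦ hp ((hg p).mp h0)
    exact ((isUnit_mk_iff hp1).mp (h1.1 _ this)).2
  · intro p hp h0 hinv
    obtain ⟨hp1, hp2⟩ := h2 p
    have := ((isUnit_mk_iff hp1).mpr ⟨h0, hinv⟩).map χ
    rw [hp2, isUnit_iff_ne_zero] at this
    exact this ((hg p).mpr hp)

theorem LocalSubring.exists_isGauss' (A : LocalSubring K)
    (hA : ∀ c : K, _root_.IsIntegral A.toSubring c → c ∈ A.toSubring) {t : K}
    (ht : t ∉ A.toSubring) (ht' : t⁻¹ ∉ A.toSubring) :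
    ∃ L : LocalSubring K, A.IsGauss L t := by
  obtain ⟨L, -, h, -⟩ := A.exists_isGauss hA ht ht'
    (F := FractionRing (ResidueField A.toSubring)[X])
    ((algebraMap _ _).comp (mapRingHom (residue A.toSubring))) fun p ↦ by
      rw [coeff_mem_maximalIdeal_iff]
      simp
  exact ⟨L, h⟩

namespace LocalSubring.IsGauss

variable {A L A' L' R : LocalSubring K} {t : K}

theorem le (h : A.IsGauss L t) : A ≤ L := by
  rw [le_iff_inv]
  have hC : ∀ a : A.toSubring, aeval t (C a) = (a : K) := fun a ↦ aeval_C _ _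
  refine ⟨fun a ha ↦ by have := h.mem (C ⟨a, ha⟩); rwa [hC] at this, fun a ha hL ↦ ?_⟩
  by_contra hinv
  have h0 : a ≠ 0 := by rintro rfl; simp at hinv
  have := h.inv_notMem (C ⟨a, ha⟩)
  rw [hC] at this
  refine this (fun i ↦ ?_) h0 hL
  rw [coeff_C]
  split_ifs
  · rw [mem_maximalIdeal_iff]; exact fun _ ↦ hinv
  · simp

theorem t_mem (h : A.IsGauss L t) : t ∈ L.toSubring := by
  simpa using h.mem X

theorem mono (h : A.IsGauss L t) (h' : A'.IsGauss L' t) (hle : A ≤ A') : L ≤ L' := by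
  have hle' := le_iff_inv.mp hle
  let j := Subring.inclusion hle'.1
  have hj : ∀ p : A.toSubring[X], aeval t (p.map j) = aeval t p := by
    intro p
    rw [aeval_def, eval₂_map, aeval_def]
    rfl
  have hmem : ∀ a, j a ∈ maximalIdeal A'.toSubring ↔ a ∈ maximalIdeal A.toSubring := by
    intro a
    rw [mem_maximalIdeal_iff, mem_maximalIdeal_iff]
    refine imp_congr_right fun h0 ↦ not_congr ⟨hle'.2 a a.2, fun h ↦ hle'.1 h⟩
  have hc : ∀ p : A.toSubring[X], (∀ i, (p.map j).coeff i ∈ maximalIdeal A'.toSubring) ↔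
      ∀ i, p.coeff i ∈ maximalIdeal A.toSubring := by
    intro p; simp only [coeff_map, hmem]
  rw [le_iff_inv]
  constructor
  · intro c hcL
    obtain ⟨p, q, hq, e⟩ := h.exists_eq c hcL
    have h1 := h'.inv_mem (q.map j) (by rwa [hc])
    rw [hj] at h1
    have h2 := h'.mem (p.map j)
    rw [hj] at h2
    have : c = aeval t p * (aeval t q)⁻¹ := by
      rw [← e, mul_assoc, mul_inv_cancel₀ (h.ne_zero q hq), mul_one]
    rw [this]
    exact mul_mem h2 h1
  · intro c hcL hcL'
    obtain ⟨p, q, hq, e⟩ := h.exists_eq c hcL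
    have hq0 := h.ne_zero q hq
    rcases eq_or_ne c 0 with rfl | h0
    · simp
    have hp0 : aeval t p ≠ 0 := by rw [← e]; exact mul_ne_zero h0 hq0
    by_cases hp : ∀ i, p.coeff i ∈ maximalIdeal A.toSubring
    · exfalso
      have h1 := h'.inv_notMem (p.map j) (by rwa [hc])
      rw [hj] at h1
      refine h1 hp0 ?_
      rw [← e, mul_inv]
      have h2 := h'.inv_mem (q.map j) (by rwa [hc])
      rw [hj] at h2
      exact mul_mem hcL' h2
    · have : c⁻¹ = aeval t q * (aeval t p)⁻¹ := by
        rw [← e, mul_inv]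
        field_simp
      rw [this]
      exact mul_mem (h.mem q) (h.inv_mem p hp)

variable {x y : R.toSubring}

theorem div_mem (h : R.IsGauss L ((x : K) / y)) (hy : (y : K) ≠ 0)
    (hm : maximalIdeal R.toSubring = Ideal.span {x, y}) {c : K} (hc : c ∈ L.toSubring)
    (hc' : c ≠ 0 → c⁻¹ ∉ L.toSubring) : c / y ∈ L.toSubring := by
  rcases eq_or_ne c 0 with rfl | h0
  · simp
  obtain ⟨p, q, hq, e⟩ := h.exists_eq c hc
  have hq0 := h.ne_zero q hq
  have hp : ∀ i, p.coeff i ∈ maximalIdeal R.toSubring := by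
    by_contra hp
    refine hc' h0 ?_
    have : c⁻¹ = aeval ((x : K) / y) q * (aeval ((x : K) / y) p)⁻¹ := by
      rw [← e, mul_inv]
      field_simp
    rw [this]
    exact mul_mem (h.mem q) (h.inv_mem p hp)
  have hRL := (le_iff_inv.mp h.le).1
  have key : aeval ((x : K) / y) p / y ∈ L.toSubring := by
    rw [aeval_eq_sum_range, Finset.sum_div]
    refine sum_mem fun i _ ↦ ?_
    have := hp i
    rw [hm, Ideal.mem_span_pair] at this
    obtain ⟨a, b, hab⟩ := this
    have e1 : (p.coeff i : K) = a * x + b * y := (congrArg Subtype.val hab).symm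
    have e2 : (p.coeff i • ((x : K) / y) ^ i) / y = (a * ((x : K) / y) + b) * ((x : K) / y) ^ i := by
      rw [Subring.smul_def, smul_eq_mul, e1]
      field_simp
    rw [e2]
    exact mul_mem (add_mem (mul_mem (hRL a.2) h.t_mem) (hRL b.2)) (pow_mem h.t_mem _)
  have : c / y = aeval ((x : K) / y) p / y * (aeval ((x : K) / y) q)⁻¹ := by
    rw [← e]
    field_simp
  rw [this]
  exact mul_mem key (h.inv_mem q hq)

theorem inv_y_notMem (h : R.IsGauss L ((x : K) / y)) (hy : (y : K) ≠ 0)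
    (hm : maximalIdeal R.toSubring = Ideal.span {x, y}) : (y : K)⁻¹ ∉ L.toSubring := by
  intro h1
  have h2 := (le_iff_inv.mp h.le).2 y y.2 h1
  have : y ∈ maximalIdeal R.toSubring := by rw [hm]; exact Ideal.subset_span (by simp)
  exact (mem_maximalIdeal_iff y).mp this hy h2

end LocalSubring.IsGauss

theorem exists_aeval_of_mem_span_pair_pow {R : Subring K} {x y : R} (hy : (y : K) ≠ 0) (n : ℕ)
    (a : R) (ha : a ∈ Ideal.span {x, y} ^ n) :
    ∃ p : R[X], p.natDegree ≤ n ∧ (a : K) = y ^ n * aeval ((x : K) / y) p := by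
  induction n generalizing a with
  | zero => exact ⟨C a, by simp, by rw [aeval_C]; simp; rfl⟩
  | succ n ih =>
    rw [pow_succ'] at ha
    refine Submodule.mul_induction_on ha ?_ ?_
    · intro b hb c hc
      obtain ⟨p, hp, e⟩ := ih c hc
      obtain ⟨r, s, rfl⟩ := Ideal.mem_span_pair.mp hb
      refine ⟨(C r * X + C s) * p, ?_, ?_⟩
      · refine natDegree_mul_le.trans ?_
        have : (C r * X + C s).natDegree ≤ 1 := natDegree_linear_le
        omega
      · have e1 : algebraMap R K r = (r : K) := rfl
        have e2 : algebraMap R K s = (s : K) := rfl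
        simp only [Subring.coe_mul, Subring.coe_add, e, map_mul, map_add, aeval_C, aeval_X, e1, e2]
        field_simp
        ring
    · rintro b c ⟨p, hp, e⟩ ⟨q, hq, e'⟩
      exact ⟨p + q, (natDegree_add_le _ _).trans (max_le hp hq), by
        rw [Subring.coe_add, e, e', map_add, mul_add]⟩

theorem mem_mul_span_pair_pow_of_aeval {R : Subring K} {x y : R} (hy : (y : K) ≠ 0) (n : ℕ)
    (a : R) (I : Ideal R) (p : R[X]) (hp : p.natDegree ≤ n) (hI : ∀ i, p.coeff i ∈ I)
    (ha : (a : K) = y ^ n * aeval ((x : K) / y) p) : a ∈ I * Ideal.span {x, y} ^ n := by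
  have : a = ∑ i ∈ Finset.range (n + 1), p.coeff i * (x ^ i * y ^ (n - i)) := by
    apply Subtype.ext
    rw [ha, aeval_eq_sum_range' (Nat.lt_succ_of_le hp), Finset.mul_sum]
    push_cast
    refine Finset.sum_congr rfl fun i hi ↦ ?_
    have : i ≤ n := Nat.lt_succ_iff.mp (Finset.mem_range.mp hi)
    obtain ⟨k, rfl⟩ := Nat.exists_eq_add_of_le this
    rw [Subring.smul_def, smul_eq_mul, Nat.add_sub_cancel_left, pow_add, div_pow]
    field_simp
  rw [this]
  refine sum_mem fun i hi ↦ Ideal.mul_mem_mul (hI i) ?_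
  have : i ≤ n := Nat.lt_succ_iff.mp (Finset.mem_range.mp hi)
  obtain ⟨k, rfl⟩ := Nat.exists_eq_add_of_le this
  rw [Nat.add_sub_cancel_left, pow_add]
  exact Ideal.mul_mem_mul (Ideal.pow_mem_pow (Ideal.subset_span (by simp)) _)
    (Ideal.pow_mem_pow (Ideal.subset_span (by simp)) _)

namespace LocalSubring.IsGauss
variable {L R : LocalSubring K} {x y : R.toSubring}

theorem exists_pow (h : R.IsGauss L ((x : K) / y)) (hR : IsNoetherianRing R.toSubring)
    (hy : (y : K) ≠ 0) (hm : maximalIdeal R.toSubring = Ideal.span {x, y}) (a : R.toSubring)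
    (ha : a ≠ 0) : ∃ n, a ∈ maximalIdeal R.toSubring ^ n ∧
      (a : K) / y ^ n ∈ L.toSubring ∧ ((a : K) / y ^ n)⁻¹ ∈ L.toSubring := by
  have hk : ∃ n, a ∉ maximalIdeal R.toSubring ^ n := by
    by_contra! hall
    apply ha
    have : a ∈ ⨅ n, maximalIdeal R.toSubring ^ n := by simpa [Ideal.mem_iInf] using hall
    rwa [Ideal.iInf_pow_eq_bot_of_isLocalRing _ (maximalIdeal.isMaximal _).ne_top] at this
  classical
  obtain ⟨n, hn⟩ : ∃ n, Nat.find hk = n + 1 := by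
    refine Nat.exists_eq_succ_of_ne_zero fun h0 ↦ ?_
    have := Nat.find_spec hk
    rw [h0] at this
    simp at this
  have h1 : a ∉ maximalIdeal R.toSubring ^ (n + 1) := hn ▸ Nat.find_spec hk
  have h2 : a ∈ maximalIdeal R.toSubring ^ n := by
    by_contra h2
    exact Nat.find_min hk (m := n) (by omega) h2
  rw [hm] at h2
  obtain ⟨p, hp, e⟩ := exists_aeval_of_mem_span_pair_pow hy n a h2
  have hp' : ¬ ∀ i, p.coeff i ∈ maximalIdeal R.toSubring := by
    intro hI
    apply h1
    rw [pow_succ', hm]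
    rw [hm] at hI
    exact mem_mul_span_pair_pow_of_aeval hy n a _ p hp hI e
  refine ⟨n, hm ▸ h2, ?_⟩
  rw [e, mul_div_cancel_left₀ _ (pow_ne_zero _ hy)]
  exact ⟨h.mem p, h.inv_mem p hp'⟩

theorem mem_or_inv_mem (h : R.IsGauss L ((x : K) / y)) (hR : R.IsSurfaceLike)
    (hy : (y : K) ≠ 0) (hm : maximalIdeal R.toSubring = Ideal.span {x, y}) (c : K) :
    c ∈ L.toSubring ∨ c⁻¹ ∈ L.toSubring := by
  obtain ⟨a, b, hb, e⟩ := hR.frac c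
  rcases eq_or_ne a 0 with rfl | ha
  · have : (b : K) ≠ 0 := by simpa using hb
    have : c = 0 := by simpa [this] using e
    simp [this]
  have hb' : (b : K) ≠ 0 := by simpa using hb
  have ha' : (a : K) ≠ 0 := by simpa using ha
  obtain ⟨n, -, hn1, hn2⟩ := h.exists_pow hR.noeth hy hm a ha
  obtain ⟨k, -, hk1, hk2⟩ := h.exists_pow hR.noeth hy hm b hb
  have hyL : (y : K) ∈ L.toSubring := (le_iff_inv.mp h.le).1 y.2
  have hc : c = a / b := by field_simp; exact e
  rcases le_total k n with hkn | hkn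
  · left
    obtain ⟨d, rfl⟩ := Nat.exists_eq_add_of_le hkn
    have : c = (a / y ^ (k + d)) * ((b : K) / y ^ k)⁻¹ * y ^ d := by
      rw [hc, pow_add]; field_simp
    rw [this]
    exact mul_mem (mul_mem hn1 hk2) (pow_mem hyL _)
  · right
    obtain ⟨d, rfl⟩ := Nat.exists_eq_add_of_le hkn
    have : c⁻¹ = (b / y ^ (n + d)) * ((a : K) / y ^ n)⁻¹ * y ^ d := by
      rw [hc, pow_add]; field_simp
    rw [this]
    exact mul_mem (mul_mem hk1 hn2) (pow_mem hyL _)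

theorem mem_pow_of_div_mem (h : R.IsGauss L ((x : K) / y)) (hR : R.IsSurfaceLike)
    (hy : (y : K) ≠ 0) (hm : maximalIdeal R.toSubring = Ideal.span {x, y}) (a : R.toSubring)
    (n : ℕ) (ha : (a : K) / y ^ n ∈ L.toSubring) : a ∈ maximalIdeal R.toSubring ^ n := by
  rcases eq_or_ne a 0 with rfl | h0
  · simp
  have ha' : (a : K) ≠ 0 := by simpa using h0
  obtain ⟨k, hk, hk1, hk2⟩ := h.exists_pow hR.noeth hy hm a h0
  rcases le_or_gt n k with hnk | hnk
  · exact Ideal.pow_le_pow_right hnk hk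
  exfalso
  obtain ⟨d, rfl⟩ := Nat.exists_eq_add_of_lt hnk
  have hyL : (y : K) ∈ L.toSubring := (le_iff_inv.mp h.le).1 y.2
  apply h.inv_y_notMem hy hm
  have : (y : K)⁻¹ = a / y ^ (k + d + 1) * ((a : K) / y ^ k)⁻¹ * y ^ d := by
    rw [pow_add, pow_add]; field_simp
  rw [this]
  exact mul_mem (mul_mem ha hk2) (pow_mem hyL _)

end LocalSubring.IsGauss

theorem mem_span_singleton_of_forall_sub_mem_pow {R : Type*} [CommRing R] [IsLocalRing R]
    [IsNoetherianRing R] {a b : R}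
    (h : ∀ n : ℕ, ∃ r, a - b * r ∈ maximalIdeal R ^ n) : b ∣ a := by
  have key := Ideal.iInf_pow_smul_eq_bot_of_isLocalRing (M := R ⧸ Ideal.span {b})
    (maximalIdeal R) (maximalIdeal.isMaximal R).ne_top
  have : (Ideal.Quotient.mk (Ideal.span {b}) a) ∈
      (⨅ i : ℕ, maximalIdeal R ^ i • ⊤ : Submodule R (R ⧸ Ideal.span {b})) := by
    rw [Submodule.mem_iInf]
    intro n
    obtain ⟨r, hr⟩ := h n
    have e : Ideal.Quotient.mk (Ideal.span {b}) a =
        (a - b * r) • (1 : R ⧸ Ideal.span {b}) := by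
      rw [Algebra.smul_def, mul_one]
      change _ = Ideal.Quotient.mk _ (a - b * r)
      rw [Ideal.Quotient.eq]
      simp [Ideal.mem_span_singleton]
    rw [e]
    exact Submodule.smul_mem_smul hr trivial
  rw [key, Submodule.mem_bot, Ideal.Quotient.eq_zero_iff_mem, Ideal.mem_span_singleton] at this
  exact this

namespace LocalSubring
variable {L R R' : LocalSubring K} {x y : R.toSubring}

theorem toSubring_eq_of_le_of_forall_mem_or_inv_mem {V V' : LocalSubring K}
    (hV : ∀ c : K, c ∈ V.toSubring ∨ c⁻¹ ∈ V.toSubring) (h : V ≤ V') : V' = V := by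
  apply toSubring_injective
  have h' := le_iff_inv.mp h
  refine le_antisymm (fun c hc ↦ ?_) h'.1
  refine (hV c).elim id fun hc' ↦ ?_
  have := h'.2 _ hc' (by rwa [inv_inv])
  rwa [inv_inv] at this

namespace IsGauss

/-- If the Gauss extensions of `R` and of a dominating `R'` agree, then the maximal ideal of `R`
extends to the one of `R'`. -/
theorem maximalIdeal_extends (h : R.IsGauss L ((x : K) / y)) (h' : R'.IsGauss L ((x : K) / y))
    (hle : R ≤ R') (hy : (y : K) ≠ 0) (hm : maximalIdeal R.toSubring = Ideal.span {x, y})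
    (hgen : ∃ x' y' : R'.toSubring, maximalIdeal R'.toSubring = Ideal.span {x', y'}) :
    ∀ z ∈ maximalIdeal R'.toSubring, ∃ u v : R'.toSubring, (z : K) = u * x + v * y := by
  obtain ⟨x', y', hm'⟩ := hgen
  have hle' := le_iff_inv.mp hle
  have hL := le_iff_inv.mp h'.le
  have hdiv : ∀ z ∈ maximalIdeal R'.toSubring, (z : K) / y ∈ L.toSubring := by
    intro z hz
    refine h.div_mem hy hm (hL.1 z.2) fun h0 hinv ↦ ?_
    exact (mem_maximalIdeal_iff z).mp hz h0 (hL.2 z z.2 hinv)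
  have hmem : ∀ z ∈ maximalIdeal R.toSubring, ∃ a b : R'.toSubring, (z : K) = a * x' + b * y' := by
    intro z hz
    have : (⟨z, hle'.1 z.2⟩ : R'.toSubring) ∈ maximalIdeal R'.toSubring := by
      rw [mem_maximalIdeal_iff] at hz ⊢
      exact fun h0 hi ↦ hz h0 (hle'.2 _ z.2 hi)
    rw [hm', Ideal.mem_span_pair] at this
    obtain ⟨a, b, e⟩ := this
    exact ⟨a, b, (congrArg Subtype.val e).symm⟩
  obtain ⟨a, b, hx⟩ := hmem x (hm ▸ Ideal.subset_span (by simp))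
  obtain ⟨c, d, hy'⟩ := hmem y (hm ▸ Ideal.subset_span (by simp))
  have hx'm : x' ∈ maximalIdeal R'.toSubring := hm' ▸ Ideal.subset_span (by simp)
  have hy'm : y' ∈ maximalIdeal R'.toSubring := hm' ▸ Ideal.subset_span (by simp)
  -- the case where the coefficient `c` is invertible
  have key : ∀ (x' y' a b c d : R'.toSubring), x' ∈ maximalIdeal R'.toSubring →
      y' ∈ maximalIdeal R'.toSubring → (x : K) = a * x' + b * y' → (y : K) = c * x' + d * y' →
      c ∉ maximalIdeal R'.toSubring →
      (∃ u v : R'.toSubring, (x' : K) = u * x + v * y) ∧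
        ∃ u v : R'.toSubring, (y' : K) = u * x + v * y := by
    intro x' y' a b c d hx'm hy'm hx hy' hc
    rw [mem_maximalIdeal_iff] at hc
    push Not at hc
    obtain ⟨hc0, hc⟩ := hc
    set e : R'.toSubring := a * ⟨_, hc⟩ with he
    have he' : (e : K) = a * (c : K)⁻¹ := rfl
    set δ : R'.toSubring := b - e * d with hδ
    have hδ' : (δ : K) = b - e * d := rfl
    have h1 : (x : K) - e * y = δ * y' := by
      rw [hδ', he', hx, hy']; field_simp; ring
    have h2 := h'.inv_mem (X - C e) (fun hI ↦ by simpa [coeff_X, coeff_C] using hI 1)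
    have h2' : aeval ((x : K) / y) (X - C e : R'.toSubring[X]) = (x : K) / y - e := by
      rw [map_sub, aeval_X, aeval_C]; rfl
    have h3 := h'.ne_zero (X - C e) (fun hI ↦ by simpa [coeff_X, coeff_C] using hI 1)
    rw [h2'] at h2 h3
    have h4 : (x : K) / y - e = δ * (y' / y) := by
      field_simp; rw [← h1]; ring
    have hδu : δ ∉ maximalIdeal R'.toSubring := by
      intro hδm
      apply h.inv_y_notMem hy hm
      have : (y : K)⁻¹ = (δ / y) * (y' / y) * ((x : K) / y - e)⁻¹ := by
        rw [eq_mul_inv_iff_mul_eq₀ h3, h4]; field_simp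
      rw [this]
      exact mul_mem (mul_mem (hdiv _ hδm) (hdiv _ hy'm)) h2
    rw [mem_maximalIdeal_iff] at hδu
    push Not at hδu
    obtain ⟨hδ0, hδi⟩ := hδu
    have hyy : (y' : K) = (δ : K)⁻¹ * x + (-(δ : K)⁻¹ * e) * y := by
      field_simp; linear_combination -h1
    refine ⟨⟨-(⟨_, hc⟩ * d * ⟨_, hδi⟩), ⟨_, hc⟩ * (1 + d * ⟨_, hδi⟩ * e), ?_⟩,
      ⟨⟨_, hδi⟩, -⟨_, hδi⟩ * e, hyy⟩⟩
    have : (x' : K) = (c : K)⁻¹ * (y - d * y') := by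
      rw [hy']; field_simp; ring
    push_cast
    rw [this, hyy]
    ring
  have hcd : c ∉ maximalIdeal R'.toSubring ∨ d ∉ maximalIdeal R'.toSubring := by
    by_contra! hcd
    apply h.inv_y_notMem hy hm
    have : (y : K)⁻¹ = (c / y) * (x' / y) + (d / y) * (y' / y) := by
      field_simp; rw [← hy']
    rw [this]
    exact add_mem (mul_mem (hdiv _ hcd.1) (hdiv _ hx'm)) (mul_mem (hdiv _ hcd.2) (hdiv _ hy'm))
  have hfin : (∃ u v : R'.toSubring, (x' : K) = u * x + v * y) ∧
        ∃ u v : R'.toSubring, (y' : K) = u * x + v * y := by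
    rcases hcd with hc | hd
    · exact key x' y' a b c d hx'm hy'm hx hy' hc
    · exact (key y' x' b a d c hy'm hx'm (by rw [hx]; ring) (by rw [hy']; ring) hd).symm
  obtain ⟨⟨u, v, hu⟩, ⟨u', v', hu'⟩⟩ := hfin
  intro z hz
  rw [hm', Ideal.mem_span_pair] at hz
  obtain ⟨p, q, rfl⟩ := hz
  refine ⟨p * u + q * u', p * v + q * v', ?_⟩
  push_cast
  rw [hu, hu']
  ring

end IsGauss

theorem le_of_div_notMem (hR : R.IsSurfaceLike) (hR' : R'.IsSurfaceLike) (hle : R ≤ R')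
    (hy : (y : K) ≠ 0) (hm : maximalIdeal R.toSubring = Ideal.span {x, y})
    (ht : (x : K) / y ∉ R'.toSubring) (ht' : ((x : K) / y)⁻¹ ∉ R'.toSubring) :
    R' = R := by
  have hle' := le_iff_inv.mp hle
  obtain ⟨V, h⟩ := R.exists_isGauss' hR.closed (fun h ↦ ht (hle'.1 h)) fun h ↦ ht' (hle'.1 h)
  obtain ⟨V', h'⟩ := R'.exists_isGauss' hR'.closed ht ht'
  have hV := h.mem_or_inv_mem hR hy hm
  obtain rfl : V' = V := toSubring_eq_of_le_of_forall_mem_or_inv_mem hV (h.mono h' hle)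
  have hext := h.maximalIdeal_extends h' hle hy hm hR'.gen
  have hRV := (le_iff_inv.mp h.le).1
  have hRV' := (le_iff_inv.mp h'.le).1
  -- `R'` has the same residue field as `R`
  have hres : ∀ c ∈ R'.toSubring, ∃ r : R.toSubring, ∃ z ∈ maximalIdeal R'.toSubring,
      c = r + z := by
    intro c hc
    obtain ⟨p, q, hq, e⟩ := h.exists_eq c (hRV' hc)
    let j := Subring.inclusion hle'.1
    have hj : ∀ p : R.toSubring[X], aeval ((x : K) / y) (p.map j) = aeval ((x : K) / y) p := by
      intro p
      rw [aeval_def, eval₂_map, aeval_def]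
      rfl
    have h0 : aeval ((x : K) / y) (C ⟨c, hc⟩ * q.map j - p.map j) = 0 := by
      rw [map_sub, map_mul, aeval_C, hj, hj, ← e]
      exact sub_self _
    have h1 := R'.coeff_mem_maximalIdeal_of_aeval_eq_zero hR'.closed ht ht' _ h0
    push Not at hq
    obtain ⟨i, hi⟩ := hq
    rw [mem_maximalIdeal_iff] at hi
    push Not at hi
    obtain ⟨hi0, hi⟩ := hi
    have h2 := h1 i
    rw [coeff_sub, coeff_C_mul, coeff_map, coeff_map] at h2
    refine ⟨⟨_, hi⟩ * p.coeff i, _, Ideal.mul_mem_left _ (j ⟨_, hi⟩) h2, ?_⟩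
    change c = (q.coeff i : K)⁻¹ * p.coeff i +
      (q.coeff i : K)⁻¹ * (c * q.coeff i - p.coeff i)
    field_simp
    ring
  have happrox : ∀ n : ℕ, ∀ c ∈ R'.toSubring, ∃ r : R.toSubring,
      (c - r) / y ^ n ∈ V'.toSubring := by
    intro n
    induction n with
    | zero =>
      intro c hc
      exact ⟨0, by simpa using hRV' hc⟩
    | succ n ih =>
      intro c hc
      obtain ⟨r, z, hz, rfl⟩ := hres c hc
      obtain ⟨u, v, e⟩ := hext z hz
      obtain ⟨u0, hu0⟩ := ih u u.2
      obtain ⟨v0, hv0⟩ := ih v v.2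
      refine ⟨r + u0 * x + v0 * y, ?_⟩
      have : ((r : K) + z - (r + u0 * x + v0 * y : R.toSubring)) / y ^ (n + 1) =
          (u - u0) / y ^ n * (x / y) + (v - v0) / y ^ n := by
        push_cast
        rw [e]; field_simp; ring
      rw [this]
      exact add_mem (mul_mem hu0 h.t_mem) hv0
  apply toSubring_injective
  refine le_antisymm (fun c hc ↦ ?_) hle'.1
  obtain ⟨a, b, hb, e⟩ := hR.frac c
  have hb' : (b : K) ≠ 0 := by simpa using hb
  have := hR.noeth
  obtain ⟨d, rfl⟩ : b ∣ a := by
    refine mem_span_singleton_of_forall_sub_mem_pow fun n ↦ ?_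
    obtain ⟨r, hr⟩ := happrox n c hc
    refine ⟨r, h.mem_pow_of_div_mem hR hy hm _ _ ?_⟩
    have : ((a - b * r : R.toSubring) : K) / y ^ n = b * ((c - r) / y ^ n) := by
      push_cast
      rw [← e]; ring
    rw [this]
    exact mul_mem (hRV b.2) hr
  have : c = d := by
    apply mul_right_cancel₀ hb'
    rw [e]; push_cast; ring
  rw [this]
  exact d.2

end LocalSubring

theorem Subring.exists_isIntegral_mul_of_isIntegral {R Q : Subring K} (M : Submonoid R)
    (hM : ∀ v ∈ M, v ≠ 0) (hfrac : ∀ c : K, ∃ a b : R, b ≠ 0 ∧ c * b = a)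
    (hQ : ∀ c ∈ Q, ∃ a : R, ∃ s ∈ M, c * (s : K) = a) {c : K} (hc : _root_.IsIntegral Q c) :
    ∃ s ∈ M, _root_.IsIntegral R ((s : K) * c) := by
  have hM' : M ≤ nonZeroDivisors R := fun v hv ↦ mem_nonZeroDivisors_of_ne_zero (hM v hv)
  have : IsFractionRing R K := IsFractionRing.of_field R K fun z ↦ by
    obtain ⟨a, b, hb, e⟩ := hfrac z
    have hb' : (b : K) ≠ 0 := by simpa using hb
    exact ⟨a, b, by change z = (a : K) / b; field_simp; exact e⟩
  let T := Localization.subalgebra.ofField K M hM'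
  have hQT : Q ≤ T.toSubring := by
    intro c hc
    obtain ⟨a, s, hs, e⟩ := hQ c hc
    have hs' : (s : K) ≠ 0 := by simpa using hM s hs
    refine ⟨a, s, hs, ?_⟩
    change c = (a : K) * (s : K)⁻¹
    rw [← e]; field_simp
  have hcT : _root_.IsIntegral T c := by
    obtain ⟨p, hp, e⟩ := hc
    refine ⟨p.map (Subring.inclusion hQT), hp.map _, ?_⟩
    rw [eval₂_map]
    exact e
  obtain ⟨s, hs⟩ := hcT.exists_multiple_integral_of_isLocalization (R := R) M
  exact ⟨s, s.2, hs⟩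

theorem Subring.exists_pow_eq_mul_of_isIntegral {Q : Subring K} (y w : Q) {c : K}
    (hc : _root_.IsIntegral Q c) (hw : (w : K) = y * c) : ∃ (d : ℕ) (q : Q), w ^ d = y * q := by
  obtain ⟨p, hp, e⟩ := hc
  have h1 : aeval (w : K) (scaleRoots p y) = 0 := by
    rw [hw]; exact scaleRoots_aeval_eq_zero e
  have h2 : eval w (scaleRoots p y) = 0 := by
    apply Subtype.coe_injective (p := (· ∈ Q))
    have := aeval_algebraMap_apply K w (scaleRoots p y)
    rw [coe_aeval_eq_eval] at this
    exact this.symm.trans h1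
  rw [eval_eq_sum_range, natDegree_scaleRoots, Finset.sum_range_succ,
    coeff_scaleRoots_natDegree, hp.leadingCoeff, one_mul, add_comm] at h2
  have h3 : y ∣ ∑ i ∈ Finset.range p.natDegree, (scaleRoots p y).coeff i * w ^ i := by
    refine Finset.dvd_sum fun i hi ↦ Dvd.dvd.mul_right ?_ _
    rw [coeff_scaleRoots]
    exact Dvd.dvd.mul_left (dvd_pow_self _ (by have := Finset.mem_range.mp hi; omega)) _
  obtain ⟨q, hq⟩ := h3
  exact ⟨p.natDegree, -q, by rw [mul_neg, ← hq]; exact eq_neg_of_add_eq_zero_left h2⟩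

namespace LocalSubring
variable {R : LocalSubring K} {x y : R.toSubring}

theorem exists_aeval_eq_mul (hy : (y : K) ≠ 0)
    (hm : maximalIdeal R.toSubring = Ideal.span {x, y}) (p : R.toSubring[X])
    (hp : ∀ i, p.coeff i ∈ maximalIdeal R.toSubring) :
    ∃ q : R.toSubring[X], aeval ((x : K) / y) p = y * aeval ((x : K) / y) q := by
  have : p ∈ (maximalIdeal R.toSubring).map C := Ideal.mem_map_C_iff.mpr hp
  rw [hm, Ideal.map_span, Set.image_pair, Ideal.mem_span_pair] at this
  obtain ⟨u, v, rfl⟩ := this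
  refine ⟨u * X + v, ?_⟩
  have e (a : R.toSubring) : algebraMap R.toSubring K a = (a : K) := rfl
  simp only [map_add, map_mul, aeval_C, aeval_X, e]
  field_simp

theorem exists_aeval_mul_pow_eq (hy : (y : K) ≠ 0) (p : R.toSubring[X]) :
    ∃ (n : ℕ) (r : R.toSubring), aeval ((x : K) / y) p * y ^ n = r := by
  induction p using Polynomial.induction_on' with
  | add p q hp hq =>
    obtain ⟨n, r, hr⟩ := hp
    obtain ⟨k, s, hs⟩ := hq
    refine ⟨n + k, r * y ^ k + s * y ^ n, ?_⟩
    push_cast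
    rw [map_add, ← hr, ← hs]
    ring
  | monomial n a =>
    refine ⟨n, a * x ^ n, ?_⟩
    rw [aeval_monomial]
    change (a : K) * _ * _ = _
    push_cast
    rw [div_pow]
    field_simp

theorem exists_quadraticTransform {F : Type*} [Field F] (hR : R.IsSurfaceLike)
    (hy : (y : K) ≠ 0) (hm : maximalIdeal R.toSubring = Ideal.span {x, y})
    (ht : (x : K) / y ∉ R.toSubring) (ht' : ((x : K) / y)⁻¹ ∉ R.toSubring)
    (φ : R.toSubring →+* F) (hφ : IsLocalHom φ) (α : F) :
    ∃ (Q : LocalSubring K) (χ : Q.toSubring →+* F), IsLocalHom χ ∧ Q.IsSurfaceLike ∧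
      (∃ h : R.toSubring ≤ Q.toSubring, ∀ a, χ (Subring.inclusion h a) = φ a) ∧
      (∀ c ∈ Q.toSubring, ∃ p q : R.toSubring[X], eval₂ φ α q ≠ 0 ∧
        c * aeval ((x : K) / y) q = aeval ((x : K) / y) p) ∧
      ∃ h : (x : K) / y ∈ Q.toSubring, χ ⟨_, h⟩ = α := by
  set t := (x : K) / y with htdef
  have hφm : ∀ a, φ a = 0 ↔ a ∈ maximalIdeal R.toSubring := by
    intro a
    rw [mem_maximalIdeal, mem_nonunits_iff, ← isUnit_map_iff φ a, isUnit_iff_ne_zero, not_not]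
  set g := eval₂RingHom φ α with hg
  have hgm : ∀ p : R.toSubring[X], (∀ i, p.coeff i ∈ maximalIdeal R.toSubring) → g p = 0 := by
    intro p hp
    simp only [hg, coe_eval₂RingHom, eval₂_eq_sum_range]
    exact Finset.sum_eq_zero fun i _ ↦ by rw [(hφm _).mpr (hp i), zero_mul]
  have hker := R.coeff_mem_maximalIdeal_of_aeval_eq_zero hR.closed ht ht'
  obtain ⟨Q, χ, h1, h2, h3, h4⟩ :=
    exists_localization (aeval t : R.toSubring[X] →ₐ[_] K).toRingHom g
      fun p hp ↦ hgm p (hker p hp)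
  change ∀ p, ∃ hp : aeval t p ∈ Q.toSubring, χ ⟨aeval t p, hp⟩ = g p at h2
  change ∀ c ∈ Q.toSubring, ∃ p q, g q ≠ 0 ∧ c * aeval t q = aeval t p at h3
  have hC : ∀ a : R.toSubring, aeval t (C a) = (a : K) := fun a ↦ aeval_C _ _
  have hne : ∀ p, g p ≠ 0 → aeval t p ≠ 0 := fun p hp h0 ↦ hp (hgm p (hker p h0))
  have hinv : ∀ p, g p ≠ 0 → (aeval t p)⁻¹ ∈ Q.toSubring := by
    intro p hp
    obtain ⟨hp1, hp2⟩ := h2 p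
    have : IsUnit (χ ⟨_, hp1⟩) := by rwa [hp2, isUnit_iff_ne_zero]
    exact ((isUnit_mk_iff hp1).mp (h1.1 _ this)).2
  have hRQ : R.toSubring ≤ Q.toSubring := fun a ha ↦ by
    have := (h2 (C ⟨a, ha⟩)).1; rwa [hC] at this
  have hext : ∀ a, χ (Subring.inclusion hRQ a) = φ a := by
    intro a
    obtain ⟨ha, e⟩ := h2 (C a)
    have h5 : g (C a) = φ a := by simp [hg]
    rw [h5] at e
    rw [← e]
    congr 1
    exact Subtype.ext (hC a).symm
  have hym : y ∈ maximalIdeal R.toSubring := hm ▸ Ideal.subset_span (by simp)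
  have hχm : ∀ c, χ c = 0 ↔ c ∈ maximalIdeal Q.toSubring := by
    intro c
    rw [mem_maximalIdeal, mem_nonunits_iff, ← isUnit_map_iff χ c, isUnit_iff_ne_zero, not_not]
  have hval : ∀ (c : Q.toSubring) p q, (c : K) * aeval t q = aeval t p → χ c * g q = g p := by
    intro c p q e
    obtain ⟨hp, ep⟩ := h2 p
    obtain ⟨hq, eq⟩ := h2 q
    rw [← ep, ← eq, ← map_mul]
    congr 1
    exact Subtype.ext e
  refine ⟨Q, χ, h1, ⟨h4 ?_, ?_, ?_, ?_⟩, ⟨hRQ, hext⟩, h3, ?_⟩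
  · have := hR.noeth
    infer_instance
  · -- division by `y` preserves membership for integral elements
    have hstep : ∀ c : K, _root_.IsIntegral Q.toSubring c → y * c ∈ Q.toSubring →
        c ∈ Q.toSubring := by
      intro c hc hyc
      obtain ⟨d, q, e⟩ := Subring.exists_pow_eq_mul_of_isIntegral
        (⟨y, hRQ y.2⟩ : Q.toSubring) ⟨_, hyc⟩ hc rfl
      have e' : ((y : K) * c) ^ d = y * q := congrArg Subtype.val e
      obtain ⟨p, u, hu, ep⟩ := h3 _ hyc
      obtain ⟨p', u', hu', ep'⟩ := h3 q q.2
      have h0 : aeval t (p ^ d * u' - C y * p' * u ^ d) = 0 := by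
        simp only [map_sub, map_mul, map_pow, hC, ← ep, ← ep', mul_pow]
        rw [mul_pow] at e'
        linear_combination (aeval t u) ^ d * aeval t u' * e'
      have h5 := hker _ h0
      have h6 : ∀ i, (p ^ d * u').coeff i ∈ maximalIdeal R.toSubring := by
        intro i
        have := h5 i
        rw [coeff_sub, mul_assoc, coeff_C_mul] at this
        simpa using add_mem this (Ideal.mul_mem_right ((p' * u ^ d).coeff i) _ hym)
      rw [coeff_mem_maximalIdeal_iff] at h6
      have h7 : u'.map (residue R.toSubring) ≠ 0 := fun h ↦
        hu' (hgm _ ((coeff_mem_maximalIdeal_iff _).mpr h))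
      rw [Polynomial.map_mul, Polynomial.map_pow, mul_eq_zero, or_iff_left h7] at h6
      have h8 := eq_zero_of_pow_eq_zero h6
      rw [← coeff_mem_maximalIdeal_iff] at h8
      obtain ⟨p'', e''⟩ := exists_aeval_eq_mul hy hm p h8
      have : c = aeval t p'' * (aeval t u)⁻¹ := by
        have := hne u hu
        field_simp
        apply mul_left_cancel₀ hy
        rw [← e'', ← mul_assoc, ep]
      rw [this]
      exact mul_mem (h2 _).1 (hinv u hu)
    have hpow : ∀ (n : ℕ) (c : K), _root_.IsIntegral Q.toSubring c → y ^ n * c ∈ Q.toSubring →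
        c ∈ Q.toSubring := by
      intro n
      induction n with
      | zero => intro c _ h; simpa using h
      | succ n ih =>
        intro c hc h
        refine hstep c hc (ih _ ?_ ?_)
        · exact (isIntegral_algebraMap (R := Q.toSubring) (x := ⟨y, hRQ y.2⟩)).mul hc
        · rwa [← mul_assoc, ← pow_succ]
    let N : Submonoid R.toSubring :=
      { carrier := {v | v ≠ 0 ∧ ∃ n : ℕ, ((v : K) / y ^ n)⁻¹ ∈ Q.toSubring}
        one_mem' := ⟨one_ne_zero, 0, by simp [one_mem]⟩
        mul_mem' := by
          rintro a b ⟨ha, n, hn⟩ ⟨hb, k, hk⟩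
          refine ⟨mul_ne_zero ha hb, n + k, ?_⟩
          have : (((a * b : R.toSubring) : K) / y ^ (n + k))⁻¹ =
              ((a : K) / y ^ n)⁻¹ * ((b : K) / y ^ k)⁻¹ := by
            push_cast
            rw [← mul_inv, pow_add, div_mul_div_comm]
          rw [this]
          exact mul_mem hn hk }
    have hN : ∀ c ∈ Q.toSubring, ∃ a : R.toSubring, ∃ s ∈ N, c * (s : K) = a := by
      intro c hc
      obtain ⟨p, q, hq, e⟩ := h3 c hc
      obtain ⟨n, r, hr⟩ := exists_aeval_mul_pow_eq (x := x) hy p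
      obtain ⟨k, s, hs⟩ := exists_aeval_mul_pow_eq (x := x) hy q
      rw [← htdef] at hr hs
      have hq0 := hne q hq
      have hs0 : (s : K) ≠ 0 := hs ▸ mul_ne_zero hq0 (pow_ne_zero _ hy)
      refine ⟨r * y ^ k, s * y ^ n, ⟨?_, k + n, ?_⟩, ?_⟩
      · exact mul_ne_zero (by simpa using hs0) (pow_ne_zero _ (by simpa using hy))
      · have : ((s * y ^ n : R.toSubring) : K) / y ^ (k + n) = aeval t q := by
          push_cast
          rw [← hs, pow_add]
          field_simp
        rw [this]
        exact hinv q hq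
      · push_cast
        rw [← hr, ← hs, ← e]
        ring
    intro c hc
    obtain ⟨s, ⟨hs0, n, hn⟩, hs⟩ :=
      Subring.exists_isIntegral_mul_of_isIntegral N (fun v hv ↦ hv.1) hR.frac hN hc
    refine hpow n c hc ?_
    have hs0' : (s : K) ≠ 0 := by simpa using hs0
    have : (y : K) ^ n * c = (s * c) * ((s : K) / y ^ n)⁻¹ := by field_simp
    rw [this]
    exact mul_mem (hRQ (hR.closed _ hs)) hn
  · let ψ : ResidueField R.toSubring →+* F := IsLocalRing.ResidueField.lift φ
    let gb : (ResidueField R.toSubring)[X] →+* F := eval₂RingHom ψ α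
    have hgb : ∀ p, gb (p.map (residue R.toSubring)) = g p := by
      intro p
      simp only [gb, hg, coe_eval₂RingHom, eval₂_map]
      rfl
    obtain ⟨hb, hhb⟩ := (IsPrincipalIdealRing.principal (RingHom.ker gb)).principal
    obtain ⟨h, rfl⟩ := Polynomial.map_surjective (residue R.toSubring) residue_surjective hb
    have hgh : g h = 0 := by
      rw [← hgb, ← RingHom.mem_ker, hhb]
      exact Submodule.mem_span_singleton_self _
    refine ⟨⟨_, (h2 h).1⟩, ⟨y, hRQ y.2⟩, le_antisymm ?_ ?_⟩
    · intro c hc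
      rw [← hχm] at hc
      obtain ⟨p, q, hq, e⟩ := h3 c c.2
      have hp : g p = 0 := by rw [← hval c p q e, hc, zero_mul]
      rw [← hgb, ← RingHom.mem_ker, hhb, Submodule.mem_span_singleton] at hp
      obtain ⟨ub, hub⟩ := hp
      obtain ⟨u, rfl⟩ := Polynomial.map_surjective (residue R.toSubring) residue_surjective ub
      have h5 : (p - u * h).map (residue R.toSubring) = 0 := by
        rw [Polynomial.map_sub, Polynomial.map_mul, ← hub, smul_eq_mul, sub_self]
      rw [← coeff_mem_maximalIdeal_iff] at h5
      obtain ⟨v, hv⟩ := exists_aeval_eq_mul hy hm _ h5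
      rw [← htdef, map_sub, map_mul] at hv
      rw [Ideal.mem_span_pair]
      refine ⟨⟨_, (h2 u).1⟩ * ⟨_, hinv q hq⟩, ⟨_, (h2 v).1⟩ * ⟨_, hinv q hq⟩, Subtype.ext ?_⟩
      have := hne q hq
      change aeval t u * (aeval t q)⁻¹ * aeval t h + aeval t v * (aeval t q)⁻¹ * y = c
      field_simp
      linear_combination -hv - e
    · rw [Ideal.span_le]
      rintro z (rfl | rfl)
      · refine (hχm _).mp ?_
        rw [(h2 h).2, hgh]
      · exact (hχm _).mp ((hext y).trans ((hφm y).mpr hym))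
  · intro c
    obtain ⟨a, b, hb, e⟩ := hR.frac c
    refine ⟨Subring.inclusion hRQ a, Subring.inclusion hRQ b, ?_, e⟩
    intro h
    have h' : (b : K) = 0 := congrArg (Subtype.val : Q.toSubring → K) h
    exact hb (by simpa using h')
  · obtain ⟨hX, e⟩ := h2 X
    have htQ : t ∈ Q.toSubring := by rwa [aeval_X] at hX
    refine ⟨htQ, ?_⟩
    have h5 : g X = α := by simp [hg]
    rw [← h5, ← e]
    congr 1
    exact Subtype.ext (aeval_X t).symm

end LocalSubring

end Gauss

section Place

open IsLocalRing Polynomial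

variable {K : Type*} [Field K]

namespace LocalSubring

/-- A local subring of `K` which is a valuation ring of `K`. -/
def IsVal (W : LocalSubring K) : Prop := ∀ c : K, c ∈ W.toSubring ∨ c⁻¹ ∈ W.toSubring

theorem exists_isVal_of_monotone (A : ℕ → LocalSubring K) (hA : Monotone A) :
    ∃ W : LocalSubring K, W.IsVal ∧ ∀ n, A n ≤ W := by
  have hdir : Directed (· ≤ ·) fun n ↦ (A n).toSubring :=
    (toSubring_mono.comp hA).directed_le
  have hloc : IsLocalRing ↥(⨆ n, (A n).toSubring : Subring K) := by
    refine ⟨fun {a b} e ↦ ?_⟩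
    obtain ⟨a, ha⟩ := a
    obtain ⟨b, hb⟩ := b
    obtain ⟨n, han⟩ := (Subring.mem_iSup_of_directed hdir).mp ha
    obtain ⟨m, hbm⟩ := (Subring.mem_iSup_of_directed hdir).mp hb
    obtain ⟨C, hCA, hCB⟩ := hdir n m
    have := (A C).isLocalRing
    refine (IsLocalRing.isUnit_or_isUnit_of_add_one (a := (⟨a, hCA han⟩ : (A C).toSubring))
      (b := ⟨b, hCB hbm⟩) (Subtype.ext (congrArg
        (Subtype.val : ↥(⨆ n, (A n).toSubring : Subring K) → K) e))).imp ?_ ?_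
    · exact fun h ↦ h.map (Subring.inclusion (le_iSup (fun n ↦ (A n).toSubring) C))
    · exact fun h ↦ h.map (Subring.inclusion (le_iSup (fun n ↦ (A n).toSubring) C))
  let U : LocalSubring K := @LocalSubring.mk _ _ (⨆ n, (A n).toSubring : Subring K) hloc
  have hU : ∀ n, A n ≤ U := by
    intro n
    rw [le_iff_inv]
    refine ⟨le_iSup (fun n ↦ (A n).toSubring) n, fun a ha hinv ↦ ?_⟩
    obtain ⟨m, hm⟩ := (Subring.mem_iSup_of_directed hdir).mp hinv
    have h1 := hA (le_max_left n m)
    have h2 := hA (le_max_right n m)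
    exact (le_iff_inv.mp h1).2 a ha (h2.1 hm)
  obtain ⟨B, hB⟩ := U.exists_le_valuationSubring
  exact ⟨B.toLocalSubring, B.mem_or_inv_mem, fun n ↦ (hU n).trans hB⟩

theorem exists_ne_zero_forall_mul_mem {R : Subring K}
    (hfrac : ∀ c : K, ∃ a b : R, b ≠ 0 ∧ c * b = a) (F : Finset K) :
    ∃ b : R, b ≠ 0 ∧ ∀ a ∈ F, (b : K) * a ∈ R := by
  classical
  induction F using Finset.induction with
  | empty => exact ⟨1, one_ne_zero, by simp⟩
  | insert c F _ ih =>
    obtain ⟨b, hb, h⟩ := ih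
    obtain ⟨u, v, hv, e⟩ := hfrac c
    refine ⟨b * v, mul_ne_zero hb hv, fun a ha ↦ ?_⟩
    rcases Finset.mem_insert.mp ha with rfl | ha
    · have : ((b * v : R) : K) * a = (b * u : R) := by
        push_cast; rw [← e]; ring
      rw [this]; exact (b * u).2
    · have : ((b * v : R) : K) * a = v * (b * a) := by push_cast; ring
      rw [this]; exact mul_mem v.2 (h a ha)

/-- A local ring of finite type is not the limit of a sequence of quadratic transforms lying
strictly below it. -/
theorem false_of_infinite_sequence (A : ℕ → LocalSubring K) (B : LocalSubring K)
    (hfrac : ∀ c : K, ∃ a b : (A 0).toSubring, b ≠ 0 ∧ c * b = a)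
    (hB : IsNoetherianRing B.toSubring) (hAB : ∀ n, A n ≤ B) (hne : ∀ n, A n ≠ B)
    (F : Finset K) (hF : ∀ a ∈ F, a ∈ B.toSubring)
    (hft : ∀ n, (∀ a ∈ F, a ∈ (A n).toSubring) → B.toSubring ≤ (A n).toSubring)
    (hstep : ∀ n, ∃ z : (A n).toSubring, z ≠ 0 ∧ z ∈ maximalIdeal (A n).toSubring ∧
      ∀ a ∈ maximalIdeal (A n).toSubring, (a : K) / z ∈ (A (n + 1)).toSubring) : False := by
  obtain ⟨b, hb, hbF⟩ := exists_ne_zero_forall_mul_mem hfrac F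
  have hb0 : (b : K) ≠ 0 := by simpa using hb
  have key : ∀ n, ∃ d : B.toSubring, d ∈ maximalIdeal B.toSubring ^ n ∧ d ≠ 0 ∧
      (b : K) / d ∈ (A n).toSubring ∧ ∀ a ∈ F, (b : K) * a / d ∈ (A n).toSubring := by
    intro n
    induction n with
    | zero => exact ⟨1, by simp, one_ne_zero, by simp, by simpa using hbF⟩
    | succ n ih =>
      obtain ⟨d, hd, hd0, hbd, hFd⟩ := ih
      have hd0' : (d : K) ≠ 0 := by simpa using hd0
      obtain ⟨z, hz0, hzm, hz⟩ := hstep n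
      have hz0' : (z : K) ≠ 0 := by simpa using hz0
      have hle := le_iff_inv.mp (hAB n)
      have hbm : (⟨_, hbd⟩ : (A n).toSubring) ∈ maximalIdeal (A n).toSubring := by
        rw [mem_maximalIdeal_iff]
        intro h0 hinv
        apply hne n
        apply toSubring_injective
        refine le_antisymm hle.1 (hft n fun a ha ↦ ?_)
        have : a = b * a / d * ((b : K) / d)⁻¹ := by field_simp
        rw [this]
        exact mul_mem (hFd a ha) hinv
      have hFm : ∀ a (ha : a ∈ F), (⟨_, hFd a ha⟩ : (A n).toSubring) ∈
          maximalIdeal (A n).toSubring := by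
        intro a ha
        rw [mem_maximalIdeal_iff] at hbm ⊢
        intro h0 hinv
        refine hbm (by positivity) (hle.2 _ hbd ?_)
        have h0' : a ≠ 0 := by rintro rfl; simp at h0
        have : ((b : K) / d)⁻¹ = a * ((b : K) * a / d)⁻¹ := by field_simp
        rw [this]
        exact mul_mem (hF a ha) (hle.1 hinv)
      have hzB : (⟨z, hle.1 z.2⟩ : B.toSubring) ∈ maximalIdeal B.toSubring := by
        rw [mem_maximalIdeal_iff] at hzm ⊢
        exact fun h0 hinv ↦ hzm h0 (hle.2 _ z.2 hinv)
      refine ⟨d * ⟨z, hle.1 z.2⟩, ?_, ?_, ?_, ?_⟩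
      · rw [pow_succ]; exact Ideal.mul_mem_mul hd hzB
      · intro h
        have : (d : K) * z = 0 := congrArg (Subtype.val : B.toSubring → K) h
        exact mul_ne_zero hd0' hz0' this
      · have := hz _ hbm
        rwa [div_div] at this
      · intro a ha
        have := hz _ (hFm a ha)
        rwa [div_div] at this
  have hbB : (⟨b, (hAB 0).1 b.2⟩ : B.toSubring) ∈ ⨅ n, maximalIdeal B.toSubring ^ n := by
    rw [Ideal.mem_iInf]
    intro n
    obtain ⟨d, hd, hd0, hbd, -⟩ := key n
    have hd0' : (d : K) ≠ 0 := by simpa using hd0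
    have : (⟨b, (hAB 0).1 b.2⟩ : B.toSubring) = d * ⟨_, (hAB n).1 hbd⟩ := by
      apply Subtype.ext
      change (b : K) = d * (b / d)
      field_simp
    rw [this]
    exact Ideal.mul_mem_right _ _ hd
  rw [Ideal.iInf_pow_eq_bot_of_isLocalRing _ (maximalIdeal.isMaximal _).ne_top] at hbB
  exact hb0 (congrArg (Subtype.val : B.toSubring → K) hbB)

end LocalSubring

/-- A local subring of `K` together with a local homomorphism to the field `M`. -/
structure LocalPlace (K M : Type*) [Field K] [Field M] where
  A : LocalSubring K
  hom : A.toSubring →+* M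
  isLocalHom : IsLocalHom hom

namespace LocalPlace
variable {M : Type*} [Field M]

/-- The order relation by extension of places. -/
protected def Le (P Q : LocalPlace K M) : Prop :=
  ∃ h : P.A.toSubring ≤ Q.A.toSubring, ∀ a, Q.hom (Subring.inclusion h a) = P.hom a

theorem hom_eq_zero_iff (P : LocalPlace K M) (a : P.A.toSubring) :
    P.hom a = 0 ↔ a ∈ maximalIdeal P.A.toSubring := by
  have := P.isLocalHom
  rw [mem_maximalIdeal, mem_nonunits_iff, ← isUnit_map_iff P.hom a, isUnit_iff_ne_zero, not_not]

theorem inv_mem (P : LocalPlace K M) (a : P.A.toSubring) (h : P.hom a ≠ 0) :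
    (a : K) ≠ 0 ∧ (a : K)⁻¹ ∈ P.A.toSubring :=
  (LocalSubring.isUnit_mk_iff a.2).mp (P.isLocalHom.1 a (isUnit_iff_ne_zero.mpr h))

theorem Le.refl (P : LocalPlace K M) : P.Le P := ⟨le_rfl, fun _ ↦ rfl⟩

theorem Le.trans {P Q R : LocalPlace K M} (h : P.Le Q) (h' : Q.Le R) : P.Le R := by
  obtain ⟨h1, h2⟩ := h
  obtain ⟨h3, h4⟩ := h'
  exact ⟨h1.trans h3, fun a ↦ (h4 (Subring.inclusion h1 a)).trans (h2 a)⟩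

theorem Le.le {P Q : LocalPlace K M} (h : P.Le Q) : P.A ≤ Q.A := by
  obtain ⟨h1, h2⟩ := h
  refine ⟨h1, ⟨fun a ha ↦ P.isLocalHom.1 a ?_⟩⟩
  rw [← h2]
  exact ha.map Q.hom

theorem Le.of_le {P Q R : LocalPlace K M} (h : P.Le R) (h' : Q.Le R) (hle : P.A ≤ Q.A) :
    P.Le Q := by
  obtain ⟨h1, h2⟩ := h
  obtain ⟨h3, h4⟩ := h'
  exact ⟨hle.1, fun a ↦ ((h4 _).symm.trans (h2 a))⟩

theorem eq_of_A_eq {P Q : LocalPlace K M} (h : P.Le Q) (h' : P.A = Q.A) : P = Q := by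
  obtain ⟨A, φ, _⟩ := P
  obtain ⟨B, ψ, _⟩ := Q
  obtain ⟨h1, h2⟩ := h
  dsimp at h'
  subst h'
  congr 1
  ext a
  exact (h2 a).symm

/-- The restriction of a place to a local subring dominated by its domain. -/
def restrict (P : LocalPlace K M) (B : LocalSubring K) (h : B ≤ P.A) : LocalPlace K M where
  A := B
  hom := P.hom.comp (Subring.inclusion h.1)
  isLocalHom := by
    have := P.isLocalHom
    have := h.2
    infer_instance

theorem restrict_le (P : LocalPlace K M) (B : LocalSubring K) (h : B ≤ P.A) :
    (P.restrict B h).Le P := ⟨h.1, fun _ ↦ rfl⟩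

/-- `P` is the specialization at `c` of the `M(T)`-valued place `(V, τ)`. -/
def IsSpecialization (V : LocalSubring K) (τ : V.toSubring →+* RatFunc M) (c : M)
    (P : LocalPlace K M) : Prop :=
  ∀ a : P.A.toSubring, ∃ ha : (a : K) ∈ V.toSubring, ∃ p q : M[X], q.eval c ≠ 0 ∧
    τ ⟨a, ha⟩ * algebraMap _ _ q = algebraMap _ _ p ∧ P.hom a * q.eval c = p.eval c

theorem IsSpecialization.of_le {V : LocalSubring K} {τ : V.toSubring →+* RatFunc M} {c : M}
    {P Q : LocalPlace K M} (h : Q.IsSpecialization V τ c) (hle : P.Le Q) :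
    P.IsSpecialization V τ c := by
  obtain ⟨h1, h2⟩ := hle
  intro a
  rw [← h2]
  exact h (Subring.inclusion h1 a)

theorem IsSpecialization.hom_eq {V : LocalSubring K} {τ : V.toSubring →+* RatFunc M} {c : M}
    {P : LocalPlace K M} (h : P.IsSpecialization V τ c) (a : P.A.toSubring)
    (ha : (a : K) ∈ V.toSubring) (p : M[X])
    (hp : τ ⟨a, ha⟩ = algebraMap _ _ p) : P.hom a = p.eval c := by
  obtain ⟨ha', p', q', h0, h1, h2⟩ := h a
  rw [hp, ← map_mul] at h1
  have h3 := RatFunc.algebraMap_injective M h1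
  rw [← h3, eval_mul] at h2
  exact mul_right_cancel₀ h0 h2

theorem exists_isSpecialization (V : LocalSubring K) (hV : V.IsVal)
    (τ : V.toSubring →+* RatFunc M) (hτ : IsLocalHom τ) (c : M) :
    ∃ W : LocalPlace K M, W.A.IsVal ∧ W.IsSpecialization V τ c ∧
      ∀ (a : V.toSubring) (p : M[X]), τ a = algebraMap _ _ p → (a : K) ∈ W.A.toSubring := by
  obtain ⟨L, χ, h1, h2, h3, -⟩ := LocalSubring.exists_localization
    (algebraMap M[X] (RatFunc M)) (evalRingHom c) fun p hp ↦ by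
      rw [(RatFunc.algebraMap_injective M).eq_iff' (map_zero _)] at hp
      simp [hp]
  have hmemL : ∀ (r : RatFunc M) (p q : M[X]), eval c q ≠ 0 →
      r * algebraMap M[X] (RatFunc M) q = algebraMap _ _ p →
      r ∈ L.toSubring := by
    intro r p q hq e
    obtain ⟨hq1, hq2⟩ := h2 q
    have hu : IsUnit (χ ⟨_, hq1⟩) := by rw [hq2]; exact isUnit_iff_ne_zero.mpr hq
    obtain ⟨h0, hi⟩ := (LocalSubring.isUnit_mk_iff hq1).mp (h1.1 _ hu)
    have : r = algebraMap _ _ p * (algebraMap M[X] (RatFunc M) q)⁻¹ := by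
      rw [← e]; field_simp
    rw [this]
    exact mul_mem (h2 p).1 hi
  have hLval : ∀ r : RatFunc M, r ∈ L.toSubring ∨ r⁻¹ ∈ L.toSubring := by
    intro r
    have hd := RatFunc.num_div_denom r
    have hd0 : algebraMap M[X] (RatFunc M) r.denom ≠ 0 := by
      rw [Ne, (RatFunc.algebraMap_injective M).eq_iff' (map_zero _)]
      exact r.denom_ne_zero
    have hrd : r * algebraMap _ _ r.denom = algebraMap _ _ r.num := by
      nth_rewrite 1 [← hd]
      field_simp
    by_cases h : eval c r.denom = 0
    · right
      have hn : eval c r.num ≠ 0 := by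
        intro hn
        obtain ⟨u, v, e⟩ := RatFunc.isCoprime_num_denom r
        have := congrArg (eval c) e
        simp [h, hn] at this
      refine hmemL _ r.denom r.num hn ?_
      have hr : r ≠ 0 := by
        rintro rfl; simp at hn
      rw [← hrd]
      field_simp
    · left
      exact hmemL _ r.num r.denom h hrd
  let S : Subring K := (L.toSubring.comap τ).map V.toSubring.subtype
  have hS : ∀ a, a ∈ S ↔ ∃ ha : a ∈ V.toSubring, τ ⟨a, ha⟩ ∈ L.toSubring := by
    intro a
    constructor
    · rintro ⟨⟨b, hb⟩, h, rfl⟩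
      exact ⟨hb, h⟩
    · rintro ⟨ha, h⟩
      exact ⟨⟨a, ha⟩, h, rfl⟩
  have hτinv : ∀ (a : V.toSubring), τ a ≠ 0 → ∃ h : (a : K)⁻¹ ∈ V.toSubring,
      τ ⟨_, h⟩ = (τ a)⁻¹ := by
    intro a ha
    obtain ⟨h0, hi⟩ := (LocalSubring.isUnit_mk_iff a.2).mp (hτ.1 a (isUnit_iff_ne_zero.mpr ha))
    refine ⟨hi, eq_inv_of_mul_eq_one_right ?_⟩
    rw [← map_mul, ← map_one τ]
    congr 1
    exact Subtype.ext (mul_inv_cancel₀ h0)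
  have hval : ∀ a : K, a ∈ S ∨ a⁻¹ ∈ S := by
    have main : ∀ a ∈ V.toSubring, a ∈ S ∨ a⁻¹ ∈ S := by
      intro a ha
      rcases eq_or_ne (τ ⟨a, ha⟩) 0 with h0 | h0
      · left; rw [hS]; exact ⟨ha, h0 ▸ zero_mem _⟩
      rcases hLval (τ ⟨a, ha⟩) with h | h
      · left; exact (hS a).mpr ⟨ha, h⟩
      · right
        obtain ⟨hi, e⟩ := hτinv ⟨a, ha⟩ h0
        exact (hS _).mpr ⟨hi, e ▸ h⟩
    intro a
    rcases hV a with h | h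
    · exact main a h
    · have := main _ h
      rwa [inv_inv, or_comm] at this
  let WV : ValuationSubring K := { S with mem_or_inv_mem' := hval }
  let ρ : S →+* L.toSubring :=
    { toFun := fun a ↦ ⟨τ ⟨a, ((hS a).mp a.2).1⟩, ((hS a).mp a.2).2⟩
      map_one' := Subtype.ext (map_one τ)
      map_zero' := Subtype.ext (map_zero τ)
      map_mul' := fun a b ↦ Subtype.ext (map_mul τ ⟨a, ((hS a).mp a.2).1⟩ ⟨b, ((hS b).mp b.2).1⟩)
      map_add' := fun a b ↦ Subtype.ext (map_add τ ⟨a, ((hS a).mp a.2).1⟩ ⟨b, ((hS b).mp b.2).1⟩) }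
  have hloc : IsLocalHom (χ.comp ρ) := by
    refine ⟨fun a ha ↦ ?_⟩
    obtain ⟨h0, hi⟩ := (LocalSubring.isUnit_mk_iff (ρ a).2).mp (h1.1 _ ha)
    change τ ⟨a, _⟩ ≠ 0 at h0
    obtain ⟨hi', e⟩ := hτinv _ h0
    have hi'' : (a : K)⁻¹ ∈ S := (hS _).mpr ⟨hi', e ▸ hi⟩
    refine isUnit_iff_exists_inv.mpr ⟨⟨_, hi''⟩, Subtype.ext (mul_inv_cancel₀ ?_)⟩
    intro ha0
    apply h0
    rw [← map_zero τ]
    congr 1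
    exact Subtype.ext ha0
  refine ⟨⟨WV.toLocalSubring, χ.comp ρ, hloc⟩, hval, fun a ↦ ?_, fun a p hp ↦ ?_⟩
  · obtain ⟨ha, haL⟩ := (hS a).mp a.2
    obtain ⟨p, q, hq, e⟩ := h3 _ haL
    refine ⟨ha, p, q, hq, e, ?_⟩
    have hq' := (h2 q).2
    have hp' := (h2 p).2
    rw [coe_evalRingHom] at hq' hp'
    rw [← hq', ← hp']
    change χ (ρ a) * _ = _
    rw [← map_mul]
    congr 1
    exact Subtype.ext e
  · refine (hS a).mpr ⟨a.2, ?_⟩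
    rw [Subtype.coe_eta, hp]
    exact (h2 p).1

end LocalPlace

end Place

section Core

open IsLocalRing Polynomial

variable {K : Type*} [Field K] {M : Type*} [Field M]

/-- Data abstracting the `M`-points of a fiber of a proper morphism to a regular surface: a set `𝒪`
of local rings of the source satisfying the valuative criterion over the base place `P₀`,
together with an equivalence relation on the places supported on `𝒪` that identifies the two ends
of any line. -/
structure FiberData (K M : Type*) [Field K] [Field M] where
  /-- The local rings of the source. -/
  𝒪 : Set (LocalSubring K)
  /-- The base place. -/
  P₀ : LocalPlace K M
  surf₀ : P₀.A.IsSurfaceLike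
  surf : ∀ B ∈ 𝒪, B.IsSurfaceLike
  exists_le : ∀ W : LocalSubring K, W.IsVal → P₀.A ≤ W → ∃ B ∈ 𝒪, B ≤ W ∧ P₀.A ≤ B
  unique : ∀ B₁ ∈ 𝒪, ∀ B₂ ∈ 𝒪, ∀ C : LocalSubring K, B₁ ≤ C → B₂ ≤ C → B₁ = B₂
  finite : ∀ B ∈ 𝒪, P₀.A ≤ B → ∃ F : Finset K, (∀ a ∈ F, a ∈ B.toSubring) ∧
    ∀ C : LocalSubring K, P₀.A ≤ C → C ≤ B → (∀ a ∈ F, a ∈ C.toSubring) →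
      B.toSubring ≤ C.toSubring
  /-- The equivalence relation. -/
  r : LocalPlace K M → LocalPlace K M → Prop
  refl : ∀ p, p.A ∈ 𝒪 → P₀.Le p → r p p
  symm : ∀ p q, r p q → r q p
  trans : ∀ p q s, r p q → r q s → r p s
  line : ∀ (V : LocalSubring K) (τ : V.toSubring →+* RatFunc M), V.IsVal → IsLocalHom τ →
    (∀ a : P₀.A.toSubring, ∃ h : (a : K) ∈ V.toSubring, τ ⟨a, h⟩ = RatFunc.C (P₀.hom a)) →
    ∀ p q : LocalPlace K M, p.A ∈ 𝒪 → P₀.Le p → q.A ∈ 𝒪 → P₀.Le q →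
      p.IsSpecialization V τ 0 → q.IsSpecialization V τ 1 → r p q

namespace FiberData
variable (D : FiberData K M)

/-- The places supported on the source over the base place. -/
def Pt (p : LocalPlace K M) : Prop := p.A ∈ D.𝒪 ∧ D.P₀.Le p

/-- All points over `P` are equivalent. -/
def Conn (P : LocalPlace K M) : Prop :=
  ∀ p q, D.Pt p → D.Pt q → P.Le p → P.Le q → D.r p q

/-- `P` is an infinitely near point which has not been reached by the source. -/
structure Good (P : LocalPlace K M) : Prop where
  base : D.P₀.Le P
  surf : P.A.IsSurfaceLike
  not_le : ∀ B ∈ D.𝒪, ¬ B ≤ P.A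
  follow : ∀ W : LocalSubring K, P.A ≤ W → ∀ B ∈ D.𝒪, D.P₀.A ≤ B → B ≤ W → P.A ≤ B

variable {D}

theorem conn_of_le {P : LocalPlace K M} {B : LocalSubring K} (hB : B ∈ D.𝒪) (h : B ≤ P.A) :
    D.Conn P := by
  intro p q hp hq hPp hPq
  have key : ∀ p, D.Pt p → P.Le p → P = p := by
    intro p hp hPp
    have h1 := D.unique B hB p.A hp.1 p.A (h.trans hPp.le) le_rfl
    exact LocalPlace.eq_of_A_eq hPp (le_antisymm hPp.le (h1 ▸ h))
  rw [← key p hp hPp, ← key q hq hPq]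
  rw [← key p hp hPp] at hp
  exact D.refl _ hp.1 hp.2

namespace Good
variable {P : LocalPlace K M}

theorem exists_generators (hP : D.Good P) : ∃ x y : P.A.toSubring, (x : K) ≠ 0 ∧ (y : K) ≠ 0 ∧
    maximalIdeal P.A.toSubring = Ideal.span {x, y} ∧
    (x : K) / y ∉ P.A.toSubring ∧ (y : K) / x ∉ P.A.toSubring := by
  have hprinc : ∀ z : P.A.toSubring, maximalIdeal P.A.toSubring ≠ Ideal.span {z} := by
    intro z hz
    have := hP.surf.noeth
    have hpr : (maximalIdeal P.A.toSubring).IsPrincipal := ⟨z, hz⟩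
    have hV : ValuationRing P.A.toSubring :=
      ((tfae_of_isNoetherianRing_of_isLocalRing_of_isDomain P.A.toSubring).out 1 4 :
        ValuationRing P.A.toSubring ↔ (maximalIdeal P.A.toSubring).IsPrincipal).mpr hpr
    have hval : P.A.IsVal := by
      intro c
      obtain ⟨a, b, hb, e⟩ := hP.surf.frac c
      have hb' : (b : K) ≠ 0 := by simpa using hb
      rcases (ValuationRing.iff_dvd_total.mp hV).total a b with ⟨d, rfl⟩ | ⟨d, rfl⟩
      · right
        have ha : (a : K) ≠ 0 := fun h ↦ hb' (by push_cast; rw [h, zero_mul])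
        have : c⁻¹ = d := by
          apply inv_eq_of_mul_eq_one_right
          apply mul_right_cancel₀ ha
          push_cast at e
          linear_combination e
        rw [this]; exact d.2
      · left
        have : c = d := by
          apply mul_right_cancel₀ hb'
          rw [e]; push_cast; ring
        rw [this]; exact d.2
    obtain ⟨B, hB, h, -⟩ := D.exists_le P.A hval hP.base.le
    exact hP.not_le B hB h
  obtain ⟨x, y, hm⟩ := hP.surf.gen
  have hdiv : ∀ x y : P.A.toSubring, maximalIdeal P.A.toSubring = Ideal.span {x, y} →
      (y : K) ≠ 0 ∧ (x : K) / y ∉ P.A.toSubring := by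
    intro x y hm
    have hy : (y : K) ≠ 0 := by
      intro h
      have : y = 0 := Subtype.ext h
      rw [this, Set.pair_comm, Ideal.span_insert_zero] at hm
      exact hprinc _ hm
    refine ⟨hy, fun h ↦ hprinc y ?_⟩
    rw [hm]
    refine le_antisymm ?_ (Ideal.span_mono (by simp))
    rw [Ideal.span_le]
    rintro z (rfl | rfl)
    · exact Ideal.mem_span_singleton'.mpr ⟨⟨_, h⟩, Subtype.ext (div_mul_cancel₀ _ hy)⟩
    · exact Ideal.subset_span rfl
  obtain ⟨hy, h1⟩ := hdiv x y hm
  obtain ⟨hx, h2⟩ := hdiv y x (by rw [hm, Set.pair_comm])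
  exact ⟨x, y, hx, hy, hm, h1, h2⟩

variable {x y : P.A.toSubring}

theorem mem_or_inv_mem (hP : D.Good P) (hy : (y : K) ≠ 0)
    (hm : maximalIdeal P.A.toSubring = Ideal.span {x, y}) {B : LocalSubring K} (hB : B ∈ D.𝒪)
    (hPB : P.A ≤ B) : (x : K) / y ∈ B.toSubring ∨ ((x : K) / y)⁻¹ ∈ B.toSubring := by
  by_contra! h
  have := LocalSubring.le_of_div_notMem hP.surf (D.surf B hB) hPB hy hm h.1 h.2
  exact hP.not_le B hB this.le

theorem mem_of_le (hP : D.Good P) (hy : (y : K) ≠ 0)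
    (hm : maximalIdeal P.A.toSubring = Ideal.span {x, y}) {B : LocalSubring K} (hB : B ∈ D.𝒪)
    (hPB : P.A ≤ B) {W : LocalSubring K} (hW : B ≤ W) (ht : (x : K) / y ∈ W.toSubring) :
    (x : K) / y ∈ B.toSubring := by
  rcases hP.mem_or_inv_mem hy hm hB hPB with h | h
  · exact h
  · have := (LocalSubring.le_iff_inv.mp hW).2 _ h
    rw [inv_inv] at this
    exact this ht

theorem exists_line (hP : D.Good P) (hy : (y : K) ≠ 0)
    (hm : maximalIdeal P.A.toSubring = Ideal.span {x, y})
    (ht : (x : K) / y ∉ P.A.toSubring) (ht' : ((x : K) / y)⁻¹ ∉ P.A.toSubring) {α β : M}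
    (hαβ : α ≠ β) : ∃ p q : LocalPlace K M, D.Pt p ∧ D.Pt q ∧ P.Le p ∧ P.Le q ∧ D.r p q ∧
      (∃ h : (x : K) / y ∈ p.A.toSubring, p.hom ⟨_, h⟩ = α) ∧
      ∃ h : (x : K) / y ∈ q.A.toSubring, q.hom ⟨_, h⟩ = β := by
  set ℓ : M[X] := C α + C (β - α) * X with hℓ
  have hℓd : ℓ.natDegree = 1 := by
    rw [hℓ, add_comm]
    exact natDegree_linear (sub_ne_zero.mpr hαβ.symm)
  let g : P.A.toSubring[X] →+* RatFunc M :=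
    (algebraMap M[X] (RatFunc M)).comp ((compRingHom ℓ).comp (mapRingHom P.hom))
  have hg : ∀ p, g p = 0 ↔ ∀ i, p.coeff i ∈ maximalIdeal P.A.toSubring := by
    intro p
    have h1 : g p = algebraMap M[X] (RatFunc M) ((p.map P.hom).comp ℓ) := rfl
    rw [h1, (RatFunc.algebraMap_injective M).eq_iff' (map_zero _), comp_eq_zero_iff]
    simp only [← LocalPlace.hom_eq_zero_iff]
    constructor
    · rintro (h | ⟨-, h⟩)
      · intro i
        rw [← coeff_map, h, coeff_zero]
      · rw [h, natDegree_C] at hℓd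
        omega
    · intro h
      left
      ext i
      rw [coeff_map, h, coeff_zero]
  obtain ⟨V, τ, hG, hτ, hτg⟩ := P.A.exists_isGauss hP.surf.closed ht ht' g hg
  have hV : V.IsVal := hG.mem_or_inv_mem hP.surf hy hm
  have hPV : ∀ a : P.A.toSubring, ∃ h : (a : K) ∈ V.toSubring,
      τ ⟨a, h⟩ = algebraMap M[X] (RatFunc M) (C (P.hom a)) := by
    intro a
    obtain ⟨h, e⟩ := hτg (C a)
    have h1 : aeval ((x : K) / y) (C a) = (a : K) := aeval_C _ _
    have h2 : g (C a) = algebraMap M[X] (RatFunc M) (C (P.hom a)) := by simp [g]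
    rw [h2] at e
    refine ⟨h1 ▸ h, ?_⟩
    rw [← e]
    congr 1
    exact Subtype.ext h1.symm
  have htV : ∃ h : (x : K) / y ∈ V.toSubring, τ ⟨_, h⟩ = algebraMap M[X] (RatFunc M) ℓ := by
    obtain ⟨h, e⟩ := hτg X
    have h1 : aeval ((x : K) / y) (X : P.A.toSubring[X]) = (x : K) / y := aeval_X _
    have h2 : g X = algebraMap M[X] (RatFunc M) ℓ := by simp [g]
    rw [h2] at e
    refine ⟨h1 ▸ h, ?_⟩
    rw [← e]
    congr 1
    exact Subtype.ext h1.symm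
  have key : ∀ c : M, ∃ p : LocalPlace K M, D.Pt p ∧ P.Le p ∧ p.IsSpecialization V τ c ∧
      ∃ h : (x : K) / y ∈ p.A.toSubring, p.hom ⟨_, h⟩ = ℓ.eval c := by
    intro c
    obtain ⟨W, hW, hWs, hWm⟩ := LocalPlace.exists_isSpecialization V hV τ hτ c
    have hPW : P.Le W := by
      have hmem : P.A.toSubring ≤ W.A.toSubring := fun a ha ↦ by
        obtain ⟨h, e⟩ := hPV ⟨a, ha⟩
        exact hWm _ _ e
      refine ⟨hmem, fun a ↦ ?_⟩
      obtain ⟨h, e⟩ := hPV a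
      have := hWs.hom_eq (Subring.inclusion hmem a) h _ e
      rw [this, eval_C]
    obtain ⟨B, hB, hBW, hPB⟩ := D.exists_le W.A hW (hP.base.trans hPW).le
    have hPB' := hP.follow W.A hPW.le B hB hPB hBW
    have hrW := W.restrict_le B hBW
    have hPp : P.Le (W.restrict B hBW) := hPW.of_le hrW hPB'
    have hs := hWs.of_le hrW
    obtain ⟨htv, e⟩ := htV
    have htB := hP.mem_of_le hy hm hB hPB' hBW (hWm _ _ e)
    exact ⟨_, ⟨hB, hP.base.trans hPp⟩, hPp, hs, htB, hs.hom_eq ⟨_, htB⟩ htv _ e⟩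
  obtain ⟨p, hp, hPp, hps, hpt⟩ := key 0
  obtain ⟨q, hq, hPq, hqs, hqt⟩ := key 1
  refine ⟨p, q, hp, hq, hPp, hPq, ?_, ?_, ?_⟩
  · refine D.line V τ hV hτ (fun a ↦ ?_) p q hp.1 hp.2 hq.1 hq.2 hps hqs
    obtain ⟨h1, h2⟩ := hP.base
    obtain ⟨h, e⟩ := hPV (Subring.inclusion h1 a)
    refine ⟨h, ?_⟩
    rw [h2] at e
    exact e.trans (RatFunc.algebraMap_C _)
  · obtain ⟨h, e⟩ := hpt
    exact ⟨h, by rw [e, hℓ]; simp⟩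
  · obtain ⟨h, e⟩ := hqt
    exact ⟨h, by rw [e, hℓ]; simp⟩

/-- A quadratic transform of a place, at a point with given coordinate. -/
theorem exists_transform (hP : D.Good P) (hy : (y : K) ≠ 0)
    (hm : maximalIdeal P.A.toSubring = Ideal.span {x, y})
    (ht : (x : K) / y ∉ P.A.toSubring) (ht' : ((x : K) / y)⁻¹ ∉ P.A.toSubring) (α : M) :
    ∃ Q : LocalPlace K M, P.Le Q ∧ (x : K) / y ∈ Q.A.toSubring ∧
      (∀ p : LocalPlace K M, P.Le p →
        (∃ h : (x : K) / y ∈ p.A.toSubring, p.hom ⟨_, h⟩ = α) → Q.Le p) ∧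
      (D.Good Q ∨ D.Conn Q) := by
  obtain ⟨Q, χ, hχ, hQ, ⟨hPQ, hext⟩, hgen, htQ, htα⟩ := LocalSubring.exists_quadraticTransform
    hP.surf hy hm ht ht' P.hom P.isLocalHom α
  set QP : LocalPlace K M := ⟨Q, χ, hχ⟩ with hQP
  have hle : P.Le QP := ⟨hPQ, hext⟩
  have heval : ∀ p : LocalPlace K M, ∀ hPp : P.Le p, ∀ ht : (x : K) / y ∈ p.A.toSubring,
      p.hom ⟨_, ht⟩ = α → ∀ f : P.A.toSubring[X],
      ∃ h : aeval ((x : K) / y) f ∈ p.A.toSubring, p.hom ⟨_, h⟩ = eval₂ P.hom α f := by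
    rintro p ⟨h1, h2⟩ ht htα f
    have e : aeval ((x : K) / y) f =
        (eval₂ (Subring.inclusion h1) ⟨_, ht⟩ f : p.A.toSubring) := by
      have := hom_eval₂ f (Subring.inclusion h1) p.A.toSubring.subtype ⟨_, ht⟩
      exact this.symm
    refine ⟨e ▸ Subtype.mem _, ?_⟩
    have : (⟨aeval ((x : K) / y) f, e ▸ Subtype.mem _⟩ : p.A.toSubring) =
      eval₂ (Subring.inclusion h1) ⟨_, ht⟩ f := Subtype.ext e
    rw [this, hom_eval₂, htα]
    congr 1
    exact RingHom.ext h2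
  refine ⟨QP, hle, htQ, ?_, ?_⟩
  · rintro p hPp ⟨htp, htpα⟩
    have hmem : ∀ c ∈ Q.toSubring, c ∈ p.A.toSubring := by
      intro c hc
      obtain ⟨f, q, hq, e⟩ := hgen c hc
      obtain ⟨hf1, hf2⟩ := heval p hPp htp htpα f
      obtain ⟨hq1, hq2⟩ := heval p hPp htp htpα q
      obtain ⟨h0, hi⟩ := p.inv_mem ⟨_, hq1⟩ (by rwa [hq2])
      have : c = aeval ((x : K) / y) f * (aeval ((x : K) / y) q)⁻¹ := by
        rw [← e]
        change _ ≠ (0 : K) at h0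
        dsimp at h0
        field_simp
      rw [this]
      exact mul_mem hf1 hi
    refine ⟨hmem, fun c ↦ ?_⟩
    obtain ⟨f, q, hq, e⟩ := hgen c c.2
    obtain ⟨hf1, hf2⟩ := heval p hPp htp htpα f
    obtain ⟨hq1, hq2⟩ := heval p hPp htp htpα q
    obtain ⟨hf3, hf4⟩ := heval QP hle htQ htα f
    obtain ⟨hq3, hq4⟩ := heval QP hle htQ htα q
    apply mul_right_cancel₀ hq
    rw [← hq2, ← map_mul]
    change _ = χ c * _
    rw [hq2, ← hq4]
    change _ = χ c * χ _
    rw [← map_mul]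
    have e1 : Subring.inclusion hmem c * ⟨_, hq1⟩ = ⟨_, hf1⟩ := Subtype.ext e
    have e2 : c * ⟨_, hq3⟩ = ⟨_, hf3⟩ := Subtype.ext e
    rw [e1, e2, hf2]
    exact hf4.symm
  · by_cases hB : ∃ B ∈ D.𝒪, B ≤ Q
    · obtain ⟨B, hB, h⟩ := hB
      exact Or.inr (conn_of_le hB h)
    · push Not at hB
      refine Or.inl ⟨hP.base.trans hle, hQ, hB, fun W hW B hB' hPB hBW ↦ ?_⟩
      have hPB' := hP.follow W (hle.le.trans hW) B hB' hPB hBW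
      have htB := hP.mem_of_le hy hm hB' hPB' hBW (hW.1 htQ)
      have haeval : ∀ f : P.A.toSubring[X], aeval ((x : K) / y) f ∈ B.toSubring := by
        intro f
        rw [aeval_eq_sum_range]
        refine sum_mem fun i _ ↦ ?_
        rw [Subring.smul_def, smul_eq_mul]
        exact mul_mem (hPB'.1 (f.coeff i).2) (pow_mem htB _)
      have hQB : Q.toSubring ≤ B.toSubring := by
        intro c hc
        obtain ⟨f, q, hq, e⟩ := hgen c hc
        obtain ⟨hq3, hq4⟩ := heval QP hle htQ htα q
        obtain ⟨h0, hi⟩ := QP.inv_mem ⟨_, hq3⟩ (by rwa [hq4])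
        dsimp at h0 hi
        have : c = aeval ((x : K) / y) f * (aeval ((x : K) / y) q)⁻¹ := by
          rw [← e]; field_simp
        rw [this]
        refine mul_mem (haeval f) ((LocalSubring.le_iff_inv.mp hBW).2 _ (haeval q) (hW.1 hi))
      rw [LocalSubring.le_iff_inv]
      refine ⟨hQB, fun a ha hi ↦ ?_⟩
      exact (LocalSubring.le_iff_inv.mp hW).2 a ha (hBW.1 hi)

theorem exists_next (hP : D.Good P) (hc : ¬ D.Conn P) :
    ∃ Q : LocalPlace K M, D.Good Q ∧ ¬ D.Conn Q ∧ P.Le Q ∧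
      ∃ z : P.A.toSubring, z ≠ 0 ∧ z ∈ maximalIdeal P.A.toSubring ∧
        ∀ a ∈ maximalIdeal P.A.toSubring, (a : K) / z ∈ Q.A.toSubring := by
  by_contra! hcon
  apply hc
  -- points in a common affine chart of the exceptional line
  have chart : ∀ x y : P.A.toSubring, (y : K) ≠ 0 →
      maximalIdeal P.A.toSubring = Ideal.span {x, y} → (x : K) / y ∉ P.A.toSubring →
      ((x : K) / y)⁻¹ ∉ P.A.toSubring → ∀ p q, D.Pt p → D.Pt q → P.Le p → P.Le q →
      (x : K) / y ∈ p.A.toSubring → (x : K) / y ∈ q.A.toSubring → D.r p q := by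
    intro x y hy hm ht ht'
    have same : ∀ α : M, ∀ p q, D.Pt p → D.Pt q → P.Le p → P.Le q →
        (∃ h : (x : K) / y ∈ p.A.toSubring, p.hom ⟨_, h⟩ = α) →
        (∃ h : (x : K) / y ∈ q.A.toSubring, q.hom ⟨_, h⟩ = α) → D.r p q := by
      intro α p q hp hq hPp hPq hpt hqt
      obtain ⟨Q, hPQ, htQ, huniv, hQ⟩ := hP.exists_transform hy hm ht ht' α
      have hQc : D.Conn Q := by
        refine hQ.elim (fun hQ ↦ ?_) id
        by_contra hQc
        obtain ⟨a, ha, ha'⟩ := hcon Q hQ hQc hPQ y (by simpa using hy)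
          (hm ▸ Ideal.subset_span (by simp))
        apply ha'
        rw [hm, Ideal.mem_span_pair] at ha
        obtain ⟨u, v, rfl⟩ := ha
        have : ((u * x + v * y : P.A.toSubring) : K) / y = u * (x / y) + v := by
          push_cast
          field_simp
        rw [this]
        exact add_mem (mul_mem (hPQ.1 u.2) htQ) (hPQ.1 v.2)
      exact hQc p q hp hq (huniv p hPp hpt) (huniv q hPq hqt)
    intro p q hp hq hPp hPq htp htq
    by_cases h : p.hom ⟨_, htp⟩ = q.hom ⟨_, htq⟩
    · exact same _ p q hp hq hPp hPq ⟨htp, h⟩ ⟨htq, rfl⟩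
    · obtain ⟨p', q', hp', hq', hPp', hPq', hr, hpt, hqt⟩ := hP.exists_line hy hm ht ht' h
      refine D.trans _ _ _ (same _ p p' hp hp' hPp hPp' ⟨htp, rfl⟩ hpt) (D.trans _ _ _ hr ?_)
      exact same _ q' q hq' hq hPq' hPq hqt ⟨htq, rfl⟩
  obtain ⟨x, y, hx, hy, hm, h1, h2⟩ := hP.exists_generators
  have hm' : maximalIdeal P.A.toSubring = Ideal.span {y, x} := by rw [hm, Set.pair_comm]
  have h1' := h1
  have h2' := h2
  rw [← inv_div] at h1' h2'
  have chart₁ := chart x y hy hm h1 h2'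
  have chart₂ := chart y x hx hm' h2 h1'
  obtain ⟨-, m, -, hmpt, -, hPm, -, -, htm, htm'⟩ :=
    hP.exists_line hy hm h1 h2' (zero_ne_one (α := M))
  have htm1 : (y : K) / x ∈ m.A.toSubring := by
    have := (m.inv_mem ⟨_, htm⟩ (by rw [htm']; exact one_ne_zero)).2
    rwa [inv_div] at this
  have toMid : ∀ p, D.Pt p → P.Le p → D.r p m := by
    intro p hp hPp
    rcases hP.mem_or_inv_mem hy hm hp.1 hPp.le with h | h
    · exact chart₁ p m hp hmpt hPp hPm h htm
    · rw [inv_div] at h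
      exact chart₂ p m hp hmpt hPp hPm h htm1
  intro p q hp hq hPp hPq
  exact D.trans _ _ _ (toMid p hp hPp) (D.symm _ _ (toMid q hq hPq))

end Good

theorem conn (D : FiberData K M) : D.Conn D.P₀ := by
  by_cases hB : ∃ B ∈ D.𝒪, B ≤ D.P₀.A
  · obtain ⟨B, hB, h⟩ := hB
    exact conn_of_le hB h
  by_contra hc
  push Not at hB
  have hgood : D.Good D.P₀ := ⟨LocalPlace.Le.refl _, D.surf₀, hB, fun W _ B _ h _ ↦ h⟩
  choose next hn using fun P : {P // D.Good P ∧ ¬ D.Conn P} ↦ P.2.1.exists_next P.2.2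
  let seq : ℕ → {P // D.Good P ∧ ¬ D.Conn P} := fun n ↦
    Nat.rec ⟨D.P₀, hgood, hc⟩ (fun _ P ↦ ⟨next P, (hn P).1, (hn P).2.1⟩) n
  have hmono : Monotone fun n ↦ (seq n).1.A :=
    monotone_nat_of_le_succ fun n ↦ (hn (seq n)).2.2.1.le
  obtain ⟨W, hW, hle⟩ := LocalSubring.exists_isVal_of_monotone _ hmono
  obtain ⟨B, hB', hBW, hPB⟩ := D.exists_le W hW (hle 0)
  have hAB : ∀ n, (seq n).1.A ≤ B := fun n ↦
    (seq n).2.1.follow W (hle n) B hB' hPB hBW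
  obtain ⟨F, hF, hft⟩ := D.finite B hB' hPB
  refine LocalSubring.false_of_infinite_sequence (fun n ↦ (seq n).1.A) B D.surf₀.frac
    (D.surf B hB').noeth hAB (fun n h ↦ (seq n).2.1.not_le B hB' h.ge) F hF
    (fun n ↦ hft _ (seq n).2.1.base.le (hAB n)) (fun n ↦ (hn (seq n)).2.2.2)

end FiberData

end Core

section RegularLocal

open IsLocalRing

variable {R : Type*} [CommRing R] [IsLocalRing R] [IsNoetherianRing R]

theorem Ideal.le_span_singleton_of_forall_exists {I : Ideal R} {g t : R}
    (ht : t ∈ maximalIdeal R) (h : ∀ a ∈ I, ∃ u, ∃ v ∈ I, a = u * g + v * t) :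
    I ≤ Ideal.span {g} := by
  refine Submodule.le_of_le_smul_of_le_jacobson_bot (I := maximalIdeal R)
    (IsNoetherian.noetherian I) (maximalIdeal_le_jacobson ⊥) fun a ha ↦ ?_
  obtain ⟨u, v, hv, rfl⟩ := h a ha
  refine Submodule.add_mem_sup (Ideal.mul_mem_left _ _ (Ideal.mem_span_singleton_self g)) ?_
  rw [mul_comm]
  exact Submodule.smul_mem_smul ht hv

variable [IsDomain R]

theorem isIntegrallyClosed_of_maximalIdeal_eq_span_pair (hdim : ringKrullDim R = 2) {x y : R}
    (hm : maximalIdeal R = Ideal.span {x, y}) : IsIntegrallyClosed R := by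
  have hmin : ∀ z, maximalIdeal R ∉ (Ideal.span {z}).minimalPrimes := by
    intro z hz
    have h1 := Ideal.height_le_one_of_isPrincipal_of_mem_minimalPrimes _ _ hz
    have h2 := maximalIdeal_height_eq_ringKrullDim (R := R)
    rw [hdim] at h2
    have h3 : (maximalIdeal R).height = 2 := WithBot.coe_injective h2
    rw [h3] at h1
    exact absurd h1 (by decide)
  have hxm : x ∈ maximalIdeal R := hm ▸ Ideal.subset_span (by simp)
  have hym : y ∈ maximalIdeal R := hm ▸ Ideal.subset_span (by simp)
  have hx0 : x ≠ 0 := by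
    rintro rfl
    rw [Ideal.span_insert_zero] at hm
    apply hmin y
    rw [← hm, Ideal.minimalPrimes_eq_subsingleton_self]
    rfl
  obtain ⟨q, hq, hqm⟩ := Ideal.exists_minimalPrimes_le (I := Ideal.span {x})
    (J := maximalIdeal R) ((Ideal.span_singleton_le_iff_mem _).mpr hxm)
  have hqp : q.IsPrime := hq.1.1
  have hxq : x ∈ q := (Ideal.span_singleton_le_iff_mem _).mp hq.1.2
  have hyq : y ∉ q := by
    intro hy
    refine hmin x ?_
    have : maximalIdeal R = q := by
      refine le_antisymm ?_ hqm
      rw [hm, Ideal.span_le]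
      rintro z (rfl | rfl) <;> assumption
    rwa [this]
  have hqx : q = Ideal.span {x} := by
    refine le_antisymm (Ideal.le_span_singleton_of_forall_exists hym fun a ha ↦ ?_) hq.1.2
    have := hqm ha
    rw [hm, Ideal.mem_span_pair] at this
    obtain ⟨u, v, rfl⟩ := this
    refine ⟨u, v, ?_, rfl⟩
    have : v * y ∈ q := (Ideal.add_mem_iff_right _ (Ideal.mul_mem_left _ _ hxq)).mp ha
    exact (hqp.mem_or_mem this).resolve_right hyq
  have hxp : Prime x := (Ideal.span_singleton_prime hx0).mp (hqx ▸ hqp)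
  have hpid : IsPrincipalIdealRing (R ⧸ q) := by
    have : Nontrivial (R ⧸ q) := Ideal.Quotient.nontrivial_iff.mpr hqp.ne_top
    have : IsLocalRing (R ⧸ q) := .of_surjective' _ Ideal.Quotient.mk_surjective
    refine ((tfae_of_isNoetherianRing_of_isLocalRing_of_isDomain (R ⧸ q)).out 0 4 :
      IsPrincipalIdealRing (R ⧸ q) ↔ (maximalIdeal (R ⧸ q)).IsPrincipal).mpr
        ⟨Ideal.Quotient.mk q y, ?_⟩
    have h1 := IsLocalRing.map_maximalIdeal_of_surjective (Ideal.Quotient.mk q)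
      Ideal.Quotient.mk_surjective
    rw [← h1, hm, Ideal.map_span, Set.image_pair, Ideal.Quotient.eq_zero_iff_mem.mpr hxq,
      Ideal.span_insert_zero]
  have hufd : UniqueFactorizationMonoid R := by
    rw [UniqueFactorizationMonoid.iff_exists_prime_mem_of_isPrime]
    intro p hp0 hp
    by_cases hxp' : x ∈ p
    · exact ⟨x, hxp', hxp⟩
    obtain ⟨c, hc⟩ := (hpid.principal (p.map (Ideal.Quotient.mk q))).principal
    have hcm : c ∈ p.map (Ideal.Quotient.mk q) := hc ▸ Submodule.mem_span_singleton_self c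
    obtain ⟨g, hg, rfl⟩ := (Ideal.mem_map_iff_of_surjective _ Ideal.Quotient.mk_surjective).mp hcm
    have hpg : p = Ideal.span {g} := by
      refine le_antisymm (Ideal.le_span_singleton_of_forall_exists hxm fun a ha ↦ ?_)
        ((Ideal.span_singleton_le_iff_mem _).mpr hg)
      have := Ideal.mem_map_of_mem (Ideal.Quotient.mk q) ha
      rw [hc] at this
      obtain ⟨d, hd⟩ := Ideal.mem_span_singleton'.mp this
      obtain ⟨u, rfl⟩ := Ideal.Quotient.mk_surjective d
      rw [← map_mul, Ideal.Quotient.eq, hqx, Ideal.mem_span_singleton'] at hd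
      obtain ⟨v, hv⟩ := hd
      refine ⟨u, -v, ?_, by linear_combination hv⟩
      have : v * x ∈ p := hv ▸ sub_mem (Ideal.mul_mem_left _ _ hg) ha
      exact neg_mem ((hp.mem_or_mem this).resolve_right hxp')
    refine ⟨g, hg, (Ideal.span_singleton_prime ?_).mp (hpg ▸ hp)⟩
    rintro rfl
    exact hp0 (by rw [hpg]; simp)
  infer_instance

theorem isIntegrallyClosed_and_exists_span_pair {n : ℕ} (g : Fin n → R)
    (hg : Ideal.span (Set.range g) = maximalIdeal R) (hn : (n : WithBot ℕ∞) = ringKrullDim R)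
    (hdim : ringKrullDim R ≤ 2) :
    IsIntegrallyClosed R ∧ ∃ x y : R, maximalIdeal R = Ideal.span {x, y} := by
  have hpr : ∀ z : R, maximalIdeal R = Ideal.span {z} →
      IsIntegrallyClosed R ∧ ∃ x y : R, maximalIdeal R = Ideal.span {x, y} := by
    intro z hz
    have : (maximalIdeal R).IsPrincipal := ⟨z, hz⟩
    have := (((tfae_of_isNoetherianRing_of_isLocalRing_of_isDomain R).out 3 4 :
      (IsIntegrallyClosed R ∧ ∀ P : Ideal R, P ≠ ⊥ → P.IsPrime → P = maximalIdeal R) ↔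
        (maximalIdeal R).IsPrincipal).mpr this).1
    exact ⟨this, 0, z, by rw [Ideal.span_insert_zero, hz]⟩
  have hn2 : n ≤ 2 := by
    rw [← hn] at hdim
    exact_mod_cast hdim
  interval_cases n
  · refine hpr 0 ?_
    rw [← hg, Set.range_eq_empty]
    simp
  · refine hpr (g 0) ?_
    rw [← hg]
    congr 1
    ext z
    simp [Fin.exists_fin_one, eq_comm]
  · have hm : maximalIdeal R = Ideal.span {g 0, g 1} := by
      rw [← hg]
      congr 1
      ext z
      simp [Fin.exists_fin_two, eq_comm]
    exact ⟨isIntegrallyClosed_of_maximalIdeal_eq_span_pair hn.symm hm, _, _, hm⟩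

end RegularLocal

section Extension
universe u

theorem AlgebraicGeometry.Scheme.PartialMap.SpecMap_stalkSpecializes_fromSpecStalkOfMem
    {X Y : Scheme.{u}} (f : X.PartialMap Y) {x y : X} (h : x ⤳ y) (hx : x ∈ f.domain)
    (hy : y ∈ f.domain) :
    Spec.map (X.presheaf.stalkSpecializes h) ≫ f.fromSpecStalkOfMem hy =
      f.fromSpecStalkOfMem hx := by
  have : Spec.map (X.presheaf.stalkSpecializes h) ≫ f.domain.fromSpecStalkOfMem y hy =
      f.domain.fromSpecStalkOfMem x hx := by
    rw [← cancel_mono f.domain.ι, Category.assoc, Scheme.Opens.fromSpecStalkOfMem_ι,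
      Scheme.Opens.fromSpecStalkOfMem_ι, Scheme.SpecMap_stalkSpecializes_fromSpecStalk]
  rw [Scheme.PartialMap.fromSpecStalkOfMem, ← Category.assoc, this]
  rfl

/-- A morphism to a proper scheme defined at the generic point of a scheme whose local rings are
valuation rings extends everywhere. -/
theorem AlgebraicGeometry.exists_extension_of_valuationRing {X Y S : Scheme.{u}} [IsIntegral X]
    (hX : ∀ x : X, ValuationRing (X.presheaf.stalk x)) [Y.IsSeparated] [S.IsSeparated]
    (sX : X ⟶ S) (f : Y ⟶ S) [IsProper f] (ξ : Spec X.functionField ⟶ Y)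
    (h : ξ ≫ f = X.fromSpecStalk _ ≫ sX) :
    ∃ F : X ⟶ Y, F ≫ f = sX ∧ X.fromSpecStalk (genericPoint X) ≫ F = ξ := by
  let ρ : X ⤏ Y := Scheme.RationalMap.ofFunctionField sX f ξ h
  have hρ : ρ.fromFunctionField = ξ := Scheme.RationalMap.fromFunctionField_ofFunctionField ..
  have hdom : ∀ x, x ∈ ρ.domain := by
    intro x
    have hV : ValuativeCriterion f := by
      have := ‹IsProper f›
      rw [IsProper.eq_valuativeCriterion] at this
      exact this.1.1.1
    have hsq : CommSq ξ (Spec.map (CommRingCat.ofHom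
        (algebraMap (X.presheaf.stalk x) X.functionField))) f (X.fromSpecStalk x ≫ sX) := by
      constructor
      rw [h, ← Category.assoc]
      congr 1
      exact (Scheme.SpecMap_stalkSpecializes_fromSpecStalk (genericPoint_specializes x)).symm
    have hdom : IsDomain (X.presheaf.stalk x) := inferInstance
    let sq : ValuativeCommSq f := @ValuativeCommSq.mk _ _ f (X.presheaf.stalk x) _ hdom (hX x)
      X.functionField _ _ inferInstance ξ (X.fromSpecStalk x ≫ sX) hsq
    obtain ⟨l, h1, h2⟩ : ∃ l : Spec (X.presheaf.stalk x) ⟶ Y,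
        Spec.map (X.presheaf.stalkSpecializes (genericPoint_specializes x)) ≫ l = ξ ∧
          l ≫ f = X.fromSpecStalk x ≫ sX := by
      obtain ⟨l, h1, h2⟩ := (hV.existence sq).exists_lift
      exact ⟨l, h1, h2⟩
    rw [Scheme.RationalMap.mem_domain]
    refine ⟨Scheme.PartialMap.ofFromSpecStalk sX f l h2,
      Scheme.PartialMap.mem_domain_ofFromSpecStalk .., ?_⟩
    apply Scheme.RationalMap.eq_of_fromFunctionField_eq
    rw [hρ, Scheme.RationalMap.fromFunctionField_toRationalMap, ← h1]
    rw [Scheme.PartialMap.fromFunctionField,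
      ← Scheme.PartialMap.SpecMap_stalkSpecializes_fromSpecStalkOfMem _
        (genericPoint_specializes x) _ (Scheme.PartialMap.mem_domain_ofFromSpecStalk ..),
      Scheme.PartialMap.fromSpecStalkOfMem_ofFromSpecStalk]
  have htop : ρ.toPartialMap.domain = ⊤ := by
    exact TopologicalSpace.Opens.ext (Set.eq_univ_of_forall hdom)
  have hr : ∀ (P : X.PartialMap Y), P.domain = ⊤ → ∃ F : X ⟶ Y, P = F.toPartialMap := by
    rintro ⟨U, hU, g⟩ rfl
    exact ⟨X.topIso.inv ≫ g, by simp [Scheme.Hom.toPartialMap]⟩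
  obtain ⟨F, hF⟩ := hr _ htop
  have hFξ : X.fromSpecStalk (genericPoint X) ≫ F = ξ := by
    rw [← hρ, ← ρ.toRationalMap_toPartialMap, Scheme.RationalMap.fromFunctionField_toRationalMap,
      hF, Scheme.PartialMap.fromFunctionField, Scheme.PartialMap.fromSpecStalkOfMem_toPartialMap]
  have hdominant : IsDominant (X.fromSpecStalk (genericPoint X)) := by
    constructor
    have : genericPoint X ∈ Set.range (X.fromSpecStalk (genericPoint X)) :=
      ⟨IsLocalRing.closedPoint _, Scheme.fromSpecStalk_closedPoint⟩
    exact dense_iff_closure_eq.mpr <| Set.univ_subset_iff.mp <|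
      (genericPoint_spec X).symm.subset.trans
        (closure_mono (Set.singleton_subset_iff.mpr this))
  refine ⟨F, ext_of_isDominant (X.fromSpecStalk (genericPoint X)) ?_, hFξ⟩
  rw [← Category.assoc, hFξ, h]

end Extension

section ExtensionPID
universe u

theorem IsLocalization.isPrincipalIdealRing {R A : Type*} [CommRing R] [CommRing A] [Algebra R A]
    (N : Submonoid R) [IsLocalization N A] [IsPrincipalIdealRing R] : IsPrincipalIdealRing A := by
  refine ⟨fun I ↦ ?_⟩
  obtain ⟨a, ha⟩ := (IsPrincipalIdealRing.principal (I.under R)).principal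
  refine ⟨algebraMap R A a, ?_⟩
  rw [← IsLocalization.map_under N A I, ha]
  change Ideal.map _ (Ideal.span {a}) = Ideal.span _
  rw [Ideal.map_span, Set.image_singleton]

theorem AlgebraicGeometry.exists_extension_of_isPrincipalIdealRing (R : CommRingCat.{u})
    [IsDomain R] [IsPrincipalIdealRing R] (L : Type u) [Field L] [Algebra R L] [IsFractionRing R L]
    {Y S : Scheme.{u}} [Y.IsSeparated] [S.IsSeparated]
    (sX : Spec R ⟶ S) (f : Y ⟶ S) [IsProper f] (ξ : Spec (.of L) ⟶ Y)
    (h : ξ ≫ f = Spec.map (CommRingCat.ofHom (algebraMap R L)) ≫ sX) :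
    ∃ F : Spec R ⟶ Y, F ≫ f = sX ∧
      Spec.map (CommRingCat.ofHom (algebraMap R L)) ≫ F = ξ := by
  let e : (Spec R).functionField ≃ₐ[R] L :=
    IsLocalization.algEquiv (nonZeroDivisors R) _ _
  let e₁ : (Spec R).functionField ⟶ CommRingCat.of L :=
    CommRingCat.ofHom (e : (Spec R).functionField →+* L)
  let e₂ : CommRingCat.of L ⟶ (Spec R).functionField :=
    CommRingCat.ofHom (e.symm : L →+* (Spec R).functionField)
  have hX : ∀ x : Spec R, ValuationRing ((Spec R).presheaf.stalk x) := by
    intro x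
    have key (y : PrimeSpectrum R) :
        IsPrincipalIdealRing ((Spec.structureSheaf R).presheaf.stalk y) := by
      have := StructureSheaf.IsLocalization.to_stalk R y
      exact IsLocalization.isPrincipalIdealRing y.asIdeal.primeCompl
    have : IsPrincipalIdealRing ((Spec R).presheaf.stalk x) := key x
    infer_instance
  have h1 : Spec.map e₂ ≫ Spec.map (CommRingCat.ofHom (algebraMap R L)) =
      (Spec R).fromSpecStalk (genericPoint (Spec R)) := by
    rw [Spec.fromSpecStalk_eq', ← Spec.map_comp]
    congr 1
    ext a
    exact e.symm.commutes a
  obtain ⟨F, hF, hFξ⟩ := exists_extension_of_valuationRing hX sX f (Spec.map e₂ ≫ ξ) (by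
      rw [Category.assoc, h, ← Category.assoc, h1])
  refine ⟨F, hF, ?_⟩
  have h2 : Spec.map e₁ ≫ Spec.map e₂ = 𝟙 _ := by
    rw [← Spec.map_comp, ← Spec.map_id]
    congr 1
    ext a
    exact e.apply_symm_apply a
  rw [← h1, Category.assoc] at hFξ
  have := congrArg (Spec.map e₁ ≫ ·) hFξ
  simp only [← Category.assoc] at this
  simpa only [h2, Category.id_comp] using this

end ExtensionPID

section LocalRings

theorem specMapOf_comp {R S T : Type} [CommRing R] [CommRing S] [CommRing T] (f : R →+* S)
    (g : S →+* T) : specMapOf (g.comp f) = specMapOf g ≫ specMapOf f := by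
  rw [specMapOf, CommRingCat.ofHom_comp, Spec.map_comp]
  rfl

theorem specMapOf_injective {R S : Type} [CommRing R] [CommRing S] {f g : R →+* S}
    (h : specMapOf f = specMapOf g) : f = g :=
  congrArg CommRingCat.Hom.hom (Spec.map_injective h)

theorem specMapOf_isDominant {R S : Type} [CommRing R] [CommRing S] {f : R →+* S}
    (hf : Function.Injective f) : IsDominant (specMapOf f) := by
  constructor
  refine (PrimeSpectrum.denseRange_comap_iff_ker_le_nilRadical f).mpr ?_
  rw [(RingHom.injective_iff_ker_eq_bot f).mp hf]
  exact bot_le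

theorem specMapOf_cancel {R S : Type} [CommRing R] [IsDomain R] [CommRing S] {f : R →+* S}
    (hf : Function.Injective f) {X : Scheme.{0}} [X.IsSeparated] {m₁ m₂ : Spec (.of R) ⟶ X}
    (h : specMapOf f ≫ m₁ = specMapOf f ≫ m₂) : m₁ = m₂ := by
  have := specMapOf_isDominant hf
  exact ext_of_isDominant (specMapOf f) h

theorem AlgebraicGeometry.Scheme.specMapOf_fromSpecStalk_closedPoint {X : Scheme.{0}} {R : Type}
    [CommRing R] [IsLocalRing R] {x : X} (φ : X.presheaf.stalk x →+* R) (hφ : IsLocalHom φ) :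
    (specMapOf φ ≫ X.fromSpecStalk x) (IsLocalRing.closedPoint R) = x := by
  have : IsLocalHom (CommRingCat.ofHom φ).hom := ‹_›
  exact (congrArg (X.fromSpecStalk x) (Spec_closedPoint (f := CommRingCat.ofHom φ))).trans
    Scheme.fromSpecStalk_closedPoint

/-- A morphism from the spectrum of a local ring is induced by a local homomorphism. -/
theorem AlgebraicGeometry.Scheme.exists_specMapOf_fromSpecStalk {X : Scheme.{0}} {R : Type}
    [CommRing R] [IsLocalRing R] (m : Spec (.of R) ⟶ X) {x : X}
    (hx : m (IsLocalRing.closedPoint R) = x) : ∃ φ : X.presheaf.stalk x →+* R,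
      IsLocalHom φ ∧ specMapOf φ ≫ X.fromSpecStalk x = m := by
  subst hx
  exact ⟨(Scheme.stalkClosedPointTo m).hom, inferInstance,
    Scheme.Spec_stalkClosedPointTo_fromSpecStalk m⟩

theorem AlgebraicGeometry.Scheme.specMapOf_fromSpecStalk_injective {X : Scheme.{0}} {R : Type}
    [CommRing R] {x : X} {φ ψ : X.presheaf.stalk x →+* R}
    (h : specMapOf φ ≫ X.fromSpecStalk x = specMapOf ψ ≫ X.fromSpecStalk x) : φ = ψ := by
  have := (cancel_mono (X.fromSpecStalk x)).mp h
  exact specMapOf_injective this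

variable {X : Scheme.{0}} [IsIntegral X] {K : Type} [Field K] (ι : X.functionField →+* K)

/-- The `K`-point of `X` over the generic point given by an embedding of the function field. -/
def genMap : Spec (.of K) ⟶ X := specMapOf ι ≫ X.fromSpecStalk (genericPoint X)

/-- The embedding of a local ring of `X` into an extension of the function field. -/
def stalkEmb (x : X) : X.presheaf.stalk x →+* K :=
  ι.comp (X.presheaf.stalkSpecializes (genericPoint_specializes x)).hom

theorem specMapOf_stalkEmb (x : X) :
    specMapOf (stalkEmb ι x) ≫ X.fromSpecStalk x = genMap ι := by
  rw [stalkEmb, specMapOf_comp, genMap, Category.assoc]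
  congr 1
  exact Scheme.SpecMap_stalkSpecializes_fromSpecStalk (genericPoint_specializes x)

theorem stalkEmb_injective (x : X) : Function.Injective (stalkEmb ι x) :=
  ι.injective.comp (IsFractionRing.injective (X.presheaf.stalk x) X.functionField)

/-- The local ring of `X` at `x`, as a local subring of `K`. -/
def locRing (x : X) : LocalSubring K := LocalSubring.range (stalkEmb ι x)

/-- The local ring of `X` at `x` is isomorphic to its image in `K`. -/
def stalkEquiv (x : X) : X.presheaf.stalk x ≃+* (locRing ι x).toSubring :=
  (RingEquiv.ofBijective (stalkEmb ι x).rangeRestrict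
    ⟨fun _ _ h ↦ stalkEmb_injective ι x (congrArg Subtype.val h),
      (stalkEmb ι x).rangeRestrict_surjective⟩)

variable {ι}

theorem exists_of_locRing_le {C : LocalSubring K} {x : X} (h : locRing ι x ≤ C) :
    ∃ m : Spec (.of C.toSubring) ⟶ X, specMapOf C.toSubring.subtype ≫ m = genMap ι ∧
      m (IsLocalRing.closedPoint C.toSubring) = x := by
  let φ : X.presheaf.stalk x →+* C.toSubring :=
    (Subring.inclusion h.1).comp (stalkEquiv ι x : _ →+* _)
  have : IsLocalHom φ := by
    have := h.2
    infer_instance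
  refine ⟨specMapOf φ ≫ X.fromSpecStalk x, ?_, Scheme.specMapOf_fromSpecStalk_closedPoint φ this⟩
  rw [← specMapOf_stalkEmb ι x, ← Category.assoc, ← specMapOf_comp]
  rfl

theorem locRing_le_of_comp {C : LocalSubring K} {m : Spec (.of C.toSubring) ⟶ X}
    (h : specMapOf C.toSubring.subtype ≫ m = genMap ι) {x : X}
    (hx : m (IsLocalRing.closedPoint C.toSubring) = x) : locRing ι x ≤ C := by
  obtain ⟨φ, hφ, hm⟩ := Scheme.exists_specMapOf_fromSpecStalk m hx
  have key : C.toSubring.subtype.comp φ = stalkEmb ι x := by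
    apply Scheme.specMapOf_fromSpecStalk_injective
    rw [specMapOf_stalkEmb, specMapOf_comp, Category.assoc, hm, h]
  have hle : (locRing ι x).toSubring ≤ C.toSubring := by
    rintro _ ⟨a, rfl⟩
    rw [← key]
    exact (φ a).2
  refine ⟨hle, ⟨fun a ha ↦ ?_⟩⟩
  obtain ⟨b, rfl⟩ := (stalkEquiv ι x).surjective a
  have : Subring.inclusion hle (stalkEquiv ι x b) = φ b :=
    Subtype.ext (RingHom.congr_fun key b).symm
  rw [this] at ha
  exact (hφ.1 b ha).map (stalkEquiv ι x)

theorem eq_of_comp [X.IsSeparated] {C : Subring K} {m₁ m₂ : Spec (.of C) ⟶ X}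
    (h₁ : specMapOf C.subtype ≫ m₁ = genMap ι) (h₂ : specMapOf C.subtype ≫ m₂ = genMap ι) :
    m₁ = m₂ := by
  have hinj : Function.Injective C.subtype := Subtype.val_injective
  have h := h₁.trans h₂.symm
  exact specMapOf_cancel hinj h

theorem eq_of_locRing_le [X.IsSeparated] {C : LocalSubring K} {x y : X} (hx : locRing ι x ≤ C)
    (hy : locRing ι y ≤ C) : x = y := by
  obtain ⟨m₁, h₁, e₁⟩ := exists_of_locRing_le hx
  obtain ⟨m₂, h₂, e₂⟩ := exists_of_locRing_le hy
  obtain rfl := eq_of_comp h₁ h₂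
  exact e₁.symm.trans e₂

variable {M : Type} [Field M]

variable (ι) in
/-- The `M`-point of `X` is given by the place `p`. -/
def Corr (p : LocalPlace K M) (z : Spec (.of M) ⟶ X) : Prop :=
  ∃ m : Spec (.of p.A.toSubring) ⟶ X, specMapOf p.A.toSubring.subtype ≫ m = genMap ι ∧
    specMapOf p.hom ≫ m = z

theorem Corr.eq [X.IsSeparated] {p : LocalPlace K M} {z₁ z₂ : Spec (.of M) ⟶ X}
    (h₁ : Corr ι p z₁) (h₂ : Corr ι p z₂) : z₁ = z₂ := by
  obtain ⟨m₁, h₁, rfl⟩ := h₁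
  obtain ⟨m₂, h₂, rfl⟩ := h₂
  rw [eq_of_comp h₁ h₂]

theorem Corr.of_le {p q : LocalPlace K M} {z : Spec (.of M) ⟶ X} (h : Corr ι p z) (hpq : p.Le q) :
    Corr ι q z := by
  obtain ⟨m, h₁, rfl⟩ := h
  obtain ⟨hle, h₂⟩ := hpq
  refine ⟨specMapOf (Subring.inclusion hle) ≫ m, ?_, ?_⟩
  · rw [← h₁, ← Category.assoc, ← specMapOf_comp]
    rfl
  · rw [← Category.assoc, ← specMapOf_comp]
    congr 2
    ext a
    exact h₂ a

variable (ι) in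
theorem exists_place (z : Spec (.of M) ⟶ X) {x : X} (hx : z (IsLocalRing.closedPoint M) = x) :
    ∃ p : LocalPlace K M, p.A = locRing ι x ∧ ∀ q, p.Le q ↔ Corr ι q z := by
  obtain ⟨φ, hφ, hz⟩ := Scheme.exists_specMapOf_fromSpecStalk z hx
  let e : (locRing ι x).toSubring →+* X.presheaf.stalk x := (stalkEquiv ι x).symm
  have he : IsLocalHom e := 
    
    ⟨fun a ha ↦ (MulEquiv.isUnit_map (stalkEquiv ι x).symm).mp ha⟩
  let p : LocalPlace K M :=
    { A := locRing ι x
      hom := φ.comp e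
      isLocalHom := inferInstance }
  let e' : X.presheaf.stalk x →+* p.A.toSubring := stalkEquiv ι x
  have hp : Corr ι p z := by
    refine ⟨specMapOf e' ≫ X.fromSpecStalk x, ?_, ?_⟩
    · rw [← specMapOf_stalkEmb ι x, ← Category.assoc, ← specMapOf_comp]
      rfl
    · rw [← Category.assoc, ← specMapOf_comp, ← hz]
      congr 2
      ext a
      exact congrArg φ ((stalkEquiv ι x).symm_apply_apply a)
  refine ⟨p, rfl, fun q ↦ ⟨hp.of_le, ?_⟩⟩
  rintro ⟨m, h₁, h₂⟩
  have hmx : m (IsLocalRing.closedPoint q.A.toSubring) = x := by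
    obtain ⟨ψ, hψ, hm⟩ := Scheme.exists_specMapOf_fromSpecStalk m rfl
    have := q.isLocalHom
    rw [← hm, ← Category.assoc, ← specMapOf_comp] at h₂
    have := Scheme.specMapOf_fromSpecStalk_closedPoint (q.hom.comp ψ) inferInstance
    rw [h₂] at this
    exact this.symm.trans hx
  have hle : locRing ι x ≤ q.A := locRing_le_of_comp h₁ hmx
  refine ⟨hle.1, fun a ↦ ?_⟩
  obtain ⟨ψ, hψ, hm⟩ := Scheme.exists_specMapOf_fromSpecStalk m hmx
  have h3 : φ = q.hom.comp ψ := by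
    apply Scheme.specMapOf_fromSpecStalk_injective
    rw [specMapOf_comp, Category.assoc, hm, hz, h₂]
  have h4 : q.A.toSubring.subtype.comp ψ = stalkEmb ι x := by
    apply Scheme.specMapOf_fromSpecStalk_injective
    rw [specMapOf_stalkEmb, specMapOf_comp, Category.assoc, hm, h₁]
  obtain ⟨b, rfl⟩ := (stalkEquiv ι x).surjective a
  have h5 : Subring.inclusion hle.1 (stalkEquiv ι x b) = ψ b :=
    Subtype.ext (RingHom.congr_fun h4 b).symm
  have h6 : p.hom (stalkEquiv ι x b) = φ b :=
    congrArg φ ((stalkEquiv ι x).symm_apply_apply b)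
  refine Eq.trans ?_ h6.symm
  rw [h3]
  exact congrArg q.hom h5

end LocalRings

section ValuativeCriterion

theorem LocalSubring.IsVal.exists_lift {K : Type} [Field K] {V : LocalSubring K} (hV : V.IsVal)
    {X Y : Scheme.{0}} (f : X ⟶ Y) [IsProper f] (ξ : Spec (.of K) ⟶ X)
    (m : Spec (.of V.toSubring) ⟶ Y) (h : ξ ≫ f = specMapOf V.toSubring.subtype ≫ m) :
    ∃ l : Spec (.of V.toSubring) ⟶ X, specMapOf V.toSubring.subtype ≫ l = ξ ∧ l ≫ f = m := by
  let A : ValuationSubring K := { V.toSubring with mem_or_inv_mem' := hV }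
  have hA : ValuationRing V.toSubring := inferInstanceAs (ValuationRing A)
  have hF : IsFractionRing V.toSubring K := inferInstanceAs (IsFractionRing A K)
  have hcrit : ValuativeCriterion f := by
    have := ‹IsProper f›
    rw [IsProper.eq_valuativeCriterion] at this
    exact this.1.1.1
  let sq : ValuativeCommSq f :=
    { R := V.toSubring, K := K, i₁ := ξ, i₂ := m, commSq := ⟨h⟩ }
  exact (hcrit.existence sq).exists_lift.elim fun l ↦ ⟨l.l, l.fac_left, l.fac_right⟩

variable {X Y : Scheme.{0}} [IsIntegral X] [IsIntegral Y] {K : Type} [Field K]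
  {ι : X.functionField →+* K} {ι' : Y.functionField →+* K} {f : X ⟶ Y}
  {M : Type} [Field M]

theorem Corr.comp (hf : genMap ι ≫ f = genMap ι') {p : LocalPlace K M} {w : Spec (.of M) ⟶ X}
    (h : Corr ι p w) : Corr ι' p (w ≫ f) := by
  obtain ⟨m, h₁, rfl⟩ := h
  exact ⟨m ≫ f, by rw [← Category.assoc, h₁, hf], (Category.assoc _ _ _).symm⟩

theorem locRing_map_le (hf : genMap ι ≫ f = genMap ι') (x : X) :
    locRing ι' (f x) ≤ locRing ι x := by
  obtain ⟨m, h₁, h₂⟩ := exists_of_locRing_le (le_refl (locRing ι x))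
  refine locRing_le_of_comp (m := m ≫ f) (by rw [← Category.assoc, h₁, hf]) ?_
  exact congrArg f h₂

theorem stalkEmb_stalkMap (hf : genMap ι ≫ f = genMap ι') (x : X)
    (a : Y.presheaf.stalk (f x)) : stalkEmb ι x ((f.stalkMap x).hom a) = stalkEmb ι' (f x) a := by
  have : (stalkEmb ι x).comp (f.stalkMap x).hom = stalkEmb ι' (f x) := by
    apply Scheme.specMapOf_fromSpecStalk_injective
    rw [specMapOf_stalkEmb, specMapOf_comp, ← hf, ← specMapOf_stalkEmb ι x, Category.assoc,
      Category.assoc, ← Scheme.SpecMap_stalkMap_fromSpecStalk]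
    rfl
  exact RingHom.congr_fun this a

theorem exists_finset_locRing [LocallyOfFiniteType f] (hf : genMap ι ≫ f = genMap ι') (x : X) :
    ∃ F : Finset K, (∀ a ∈ F, a ∈ (locRing ι x).toSubring) ∧
      ∀ C : LocalSubring K, locRing ι' (f x) ≤ C → C ≤ locRing ι x → (∀ a ∈ F, a ∈ C.toSubring) →
        (locRing ι x).toSubring ≤ C.toSubring := by
  classical
  obtain ⟨_, ⟨U, hU, rfl⟩, hxU, -⟩ := Y.isBasis_affineOpens.exists_subset_of_mem_open
    (Set.mem_univ (f x)) isOpen_univ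
  obtain ⟨_, ⟨V, hV, rfl⟩, hxV, hVU⟩ := X.isBasis_affineOpens.exists_subset_of_mem_open
    (show x ∈ ((f ⁻¹ᵁ U : X.Opens) : Set X) from hxU) (f ⁻¹ᵁ U).isOpen
  have hft : (f.appLE U V hVU).hom.FiniteType := f.finiteType_appLE hU hV hVU
  let g := (f.appLE U V hVU).hom
  let := g.toAlgebra
  obtain ⟨T, hT⟩ := (show Algebra.FiniteType Γ(Y, U) Γ(X, V) from hft).out
  let γ : Γ(X, V) →+* K := (stalkEmb ι x).comp (X.presheaf.germ V x hxV).hom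
  have hγ (a : Γ(Y, U)) : γ (g a) = stalkEmb ι' (f x) ((Y.presheaf.germ U (f x) hxU).hom a) := by
    rw [← stalkEmb_stalkMap hf]
    refine congrArg (stalkEmb ι x) ?_
    change (f.appLE U V hVU ≫ X.presheaf.germ V x hxV).hom a =
      (Y.presheaf.germ U (f x) hxU ≫ f.stalkMap x).hom a
    rw [f.germ_stalkMap, ← X.presheaf.germ_res (homOfLE hVU) _ hxV, Scheme.Hom.app_eq_appLE,
      Scheme.Hom.appLE_map_assoc]
  refine ⟨T.image γ, ?_, fun C h₁ h₂ h₃ ↦ ?_⟩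
  · intro a ha
    obtain ⟨t, -, rfl⟩ := Finset.mem_image.mp ha
    exact ⟨_, rfl⟩
  have hC (t : Γ(X, V)) : γ t ∈ C.toSubring := by
    have ht : t ∈ Algebra.adjoin Γ(Y, U) (T : Set Γ(X, V)) := hT ▸ Algebra.mem_top
    induction ht using Algebra.adjoin_induction with
    | mem t ht => exact h₃ _ (Finset.mem_image_of_mem _ ht)
    | algebraMap r => exact (hγ r).symm ▸ h₁.1 ⟨_, rfl⟩
    | add _ _ _ _ ha hb => rw [map_add]; exact add_mem ha hb
    | mul _ _ _ _ ha hb => rw [map_mul]; exact mul_mem ha hb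
  rintro _ ⟨b, rfl⟩
  let := X.presheaf.algebra_section_stalk ⟨x, hxV⟩
  have := hV.isLocalization_stalk ⟨x, hxV⟩
  obtain ⟨⟨c, d⟩, hcd⟩ := IsLocalization.surj (hV.primeIdealOf ⟨x, hxV⟩).asIdeal.primeCompl b
  have hd := IsLocalization.map_units (X.presheaf.stalk x) d
  have h4 : stalkEmb ι x b * γ d = γ c :=
    (map_mul (stalkEmb ι x) b _).symm.trans (congrArg (stalkEmb ι x) hcd)
  obtain ⟨h5, h6⟩ := (LocalSubring.isUnit_mk_iff _).mp (hd.map (stalkEquiv ι x))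
  have h7 : (γ d)⁻¹ ∈ C.toSubring := (LocalSubring.le_iff_inv.mp h₂).2 _ (hC d) h6
  have h8 : γ d ≠ 0 := h5
  rw [eq_div_of_mul_eq h8 h4, div_eq_mul_inv]
  exact mul_mem (hC c) h7

end ValuativeCriterion

section Points

theorem exists_lift_specMapOf_polynomial {X Y : Scheme.{0}} [X.IsSeparated] [Y.IsSeparated]
    {f : X ⟶ Y} [IsProper f] {M N : Type} [Field M] [Field N] [Algebra (Polynomial M) N]
    [IsFractionRing (Polynomial M) N] (ξ : Spec (.of N) ⟶ X) (sX : Spec (.of (Polynomial M)) ⟶ Y)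
    (h : ξ ≫ f = specMapOf (algebraMap (Polynomial M) N) ≫ sX) :
    ∃ F : Spec (.of (Polynomial M)) ⟶ X, F ≫ f = sX ∧
      specMapOf (algebraMap (Polynomial M) N) ≫ F = ξ := by
  have : IsDomain (CommRingCat.of (Polynomial M)) := inferInstanceAs (IsDomain (Polynomial M))
  have : IsPrincipalIdealRing (CommRingCat.of (Polynomial M)) :=
    inferInstanceAs (IsPrincipalIdealRing (Polynomial M))
  exact exists_extension_of_isPrincipalIdealRing (.of (Polynomial M)) N sX f ξ h

variable {X Y : Scheme.{0}} [IsIntegral X] [IsIntegral Y] {K : Type} [Field K]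
  {ι : X.functionField →+* K} {ι' : Y.functionField →+* K} {f : X ⟶ Y}
  {M : Type} [Field M]

theorem Corr.map {N : Type} [Field N] (σ : M →+* N) {p : LocalPlace K M} {q : LocalPlace K N}
    {z : Spec (.of M) ⟶ X} (h : Corr ι p z) (hle : p.A.toSubring ≤ q.A.toSubring)
    (hσ : ∀ a, q.hom (Subring.inclusion hle a) = σ (p.hom a)) :
    Corr ι q (specMapOf σ ≫ z) := by
  obtain ⟨m, h₁, rfl⟩ := h
  refine ⟨specMapOf (Subring.inclusion hle) ≫ m, ?_, ?_⟩
  · rw [← h₁, ← Category.assoc, ← specMapOf_comp]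
    rfl
  · rw [← Category.assoc, ← Category.assoc, ← specMapOf_comp, ← specMapOf_comp]
    congr 2
    ext a
    exact hσ a

theorem corr_eval_of_isSpecialization [X.IsSeparated] {V : LocalSubring K}
    {τ : V.toSubring →+* RatFunc M} {l : Spec (.of V.toSubring) ⟶ X}
    (hl : specMapOf V.toSubring.subtype ≫ l = genMap ι) {F : Spec (.of (Polynomial M)) ⟶ X}
    (hF : specMapOf (algebraMap (Polynomial M) (RatFunc M)) ≫ F = specMapOf τ ≫ l)
    {p : LocalPlace K M} {x : X} (hx : p.A = locRing ι x) {c : M} (hp : p.IsSpecialization V τ c) :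
    Corr ι p (specMapOf (Polynomial.evalRingHom c) ≫ F) := by
  obtain ⟨m, hm, -⟩ := exists_of_locRing_le hx.ge
  obtain ⟨L, χ, hχ, h₂, -, -⟩ := LocalSubring.exists_localization
    (algebraMap (Polynomial M) (RatFunc M)) (Polynomial.evalRingHom c) fun p hp ↦ by
      rw [(RatFunc.algebraMap_injective M).eq_iff' (map_zero _)] at hp
      simp [hp]
  have hle : p.A.toSubring ≤ V.toSubring := fun a ha ↦ (hp ⟨a, ha⟩).choose
  have key (a : p.A.toSubring) : ∃ h : τ (Subring.inclusion hle a) ∈ L.toSubring,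
      χ ⟨_, h⟩ = p.hom a := by
    obtain ⟨ha, u, v, h0, h1, h2⟩ := hp a
    obtain ⟨hv, hv'⟩ := h₂ v
    obtain ⟨hu, hu'⟩ := h₂ u
    have hunit : IsUnit (χ ⟨_, hv⟩) := by rw [hv']; exact isUnit_iff_ne_zero.mpr h0
    obtain ⟨h3, h4⟩ := (LocalSubring.isUnit_mk_iff hv).mp (hχ.1 _ hunit)
    have h5 : τ (Subring.inclusion hle a) ∈ L.toSubring := by
      have : τ (Subring.inclusion hle a) = algebraMap _ _ u * (algebraMap _ (RatFunc M) v)⁻¹ := by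
        rw [← div_eq_mul_inv]
        exact eq_div_of_mul_eq h3 h1
      rw [this]
      exact mul_mem hu h4
    refine ⟨h5, ?_⟩
    have h6 : χ ⟨_, h5⟩ * χ ⟨_, hv⟩ = χ ⟨_, hu⟩ := by
      rw [← map_mul]
      exact congrArg χ (Subtype.ext h1)
    rw [hv', hu'] at h6
    exact mul_right_cancel₀ h0 (h6.trans h2.symm)
  let σ : p.A.toSubring →+* L.toSubring :=
    (τ.comp (Subring.inclusion hle)).codRestrict L.toSubring fun a ↦ (key a).choose
  let ψ : Polynomial M →+* L.toSubring :=
    (algebraMap (Polynomial M) (RatFunc M)).codRestrict L.toSubring fun a ↦ (h₂ a).choose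
  have hχσ : χ.comp σ = p.hom := RingHom.ext fun a ↦ (key a).choose_spec
  have hχψ : χ.comp ψ = Polynomial.evalRingHom c := RingHom.ext fun a ↦ (h₂ a).choose_spec
  have hml : specMapOf (Subring.inclusion hle) ≫ m = l := by
    refine eq_of_comp ?_ hl
    rw [← Category.assoc, ← specMapOf_comp]
    exact hm
  have heq : specMapOf σ ≫ m = specMapOf ψ ≫ F := by
    refine specMapOf_cancel (f := L.toSubring.subtype) Subtype.val_injective ?_
    rw [← Category.assoc, ← Category.assoc, ← specMapOf_comp, ← specMapOf_comp]
    refine Eq.trans ?_ hF.symm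
    rw [← hml, ← Category.assoc, ← specMapOf_comp]
    rfl
  refine ⟨m, hm, ?_⟩
  rw [← hχσ, ← hχψ, specMapOf_comp, specMapOf_comp, Category.assoc, Category.assoc, heq]

theorem rel_of_isSurfaceLike [X.IsSeparated] [Y.IsSeparated] [IsProper f]
    (hf : genMap ι ≫ f = genMap ι') (hX : ∀ x, (locRing ι x).IsSurfaceLike)
    (hY : ∀ y, (locRing ι' y).IsSurfaceLike) (z : Spec (.of M) ⟶ Y)
    (E : (Spec (.of M) ⟶ X) → (Spec (.of M) ⟶ X) → Prop) (hrefl : ∀ w, w ≫ f = z → E w w)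
    (hsymm : ∀ w w', E w w' → E w' w) (htrans : ∀ w₁ w₂ w₃, E w₁ w₂ → E w₂ w₃ → E w₁ w₃)
    (hline : ∀ F : Spec (.of (Polynomial M)) ⟶ X, F ≫ f = specMapOf Polynomial.C ≫ z →
      E (specMapOf (Polynomial.evalRingHom 0) ≫ F) (specMapOf (Polynomial.evalRingHom 1) ≫ F))
    (w₀ w₁ : Spec (.of M) ⟶ X) (hw₀ : w₀ ≫ f = z) (hw₁ : w₁ ≫ f = z) : E w₀ w₁ := by
  obtain ⟨P₀, hP₀, hz⟩ := exists_place ι' z rfl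
  obtain ⟨p₀, hp₀, hz₀⟩ := exists_place ι w₀ rfl
  obtain ⟨p₁, hp₁, hz₁⟩ := exists_place ι w₁ rfl
  have hf' {x : X} (h : P₀.A ≤ locRing ι x) : P₀.A = locRing ι' (f x) := by
    rw [hP₀] at h ⊢
    rw [eq_of_locRing_le h (locRing_map_le hf x)]
  let D : FiberData K M :=
    { 𝒪 := Set.range (locRing ι)
      P₀ := P₀
      surf₀ := hP₀ ▸ hY _
      surf := by
        rintro _ ⟨x, rfl⟩
        exact hX x
      exists_le := by
        intro W hW hle
        rw [hP₀] at hle ⊢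
        obtain ⟨m, h₁, h₂⟩ := exists_of_locRing_le hle
        obtain ⟨l, h₃, rfl⟩ := hW.exists_lift f (genMap ι) m (hf.trans h₁.symm)
        refine ⟨_, ⟨_, rfl⟩, locRing_le_of_comp h₃ rfl, ?_⟩
        rw [← h₂]
        exact locRing_map_le hf _
      unique := by
        rintro _ ⟨x, rfl⟩ _ ⟨y, rfl⟩ C h₁ h₂
        rw [eq_of_locRing_le h₁ h₂]
      finite := by
        rintro _ ⟨x, rfl⟩ hle
        rw [hf' hle]
        exact exists_finset_locRing hf x
      r := fun p q ↦ ∃ w w', Corr ι p w ∧ Corr ι q w' ∧ E w w'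
      refl := by
        rintro p ⟨x, hx⟩ hle
        obtain ⟨m, hm, -⟩ := exists_of_locRing_le hx.le
        have hc : Corr ι p (specMapOf p.hom ≫ m) := ⟨m, hm, rfl⟩
        exact ⟨_, _, hc, hc, hrefl _ ((hc.comp hf).eq ((hz p).mp hle))⟩
      symm := fun p q ⟨w, w', h₁, h₂, h₃⟩ ↦ ⟨w', w, h₂, h₁, hsymm _ _ h₃⟩
      trans := by
        rintro p q s ⟨w, w', h₁, h₂, h₃⟩ ⟨v, v', h₁', h₂', h₃'⟩
        obtain rfl := h₂.eq h₁'
        exact ⟨_, _, h₁, h₂', htrans _ _ _ h₃ h₃'⟩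
      line := by
        rintro V τ hV hτ h p q ⟨x, hx⟩ - ⟨y, hy⟩ - hp hq
        obtain ⟨m, h₁, h₂⟩ := ((hz P₀).mp (.refl P₀)).map (q := ⟨V, τ, hτ⟩) RatFunc.C
          (fun a ha ↦ (h ⟨a, ha⟩).choose) fun a ↦ (h a).choose_spec
        obtain ⟨l, h₃, rfl⟩ := hV.exists_lift f (genMap ι) m (hf.trans h₁.symm)
        obtain ⟨F, h₄, h₅⟩ := exists_lift_specMapOf_polynomial (N := RatFunc M) (f := f)
          (specMapOf τ ≫ l) (specMapOf Polynomial.C ≫ z) (by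
            rw [Category.assoc]
            refine h₂.trans ?_
            rw [← Category.assoc, ← specMapOf_comp]
            rfl)
        exact ⟨_, _, corr_eval_of_isSpecialization h₃ h₅ hx.symm hp,
          corr_eval_of_isSpecialization h₃ h₅ hy.symm hq, hline F h₄⟩ }
  have hD : ∀ p w x, p.A = locRing ι x → (∀ q, p.Le q ↔ Corr ι q w) → w ≫ f = z →
      Corr ι p w ∧ D.Pt p := by
    intro p w x hx h hw
    have hc := (h p).mp (.refl p)
    exact ⟨hc, ⟨x, hx.symm⟩, (hz p).mpr (hw ▸ hc.comp hf)⟩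
  obtain ⟨hc₀, hPt₀⟩ := hD p₀ w₀ _ hp₀ hz₀ hw₀
  obtain ⟨hc₁, hPt₁⟩ := hD p₁ w₁ _ hp₁ hz₁ hw₁
  obtain ⟨v₀, v₁, h₀, h₁, hE⟩ := D.conn p₀ p₁ hPt₀ hPt₁ hPt₀.2 hPt₁.2
  rwa [hc₀.eq h₀, hc₁.eq h₁]

end Points

section Birational

theorem AlgebraicGeometry.Scheme.ringKrullDim_stalk_le_topologicalKrullDim (X : Scheme.{0})
    (x : X) :
    ringKrullDim (X.presheaf.stalk x) ≤ topologicalKrullDim X := by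
  rw [ringKrullDim_stalk_eq_coheight x, topologicalKrullDim]
  let := specializationOrder X
  rw [Order.krullDim_eq_of_orderIso (irreducibleSetEquivPoints (α := X))]
  exact Order.coheight_le_krullDim x

theorem isSurfaceLike_locRing {X : Scheme.{0}} [IsIntegral X] {K : Type} [Field K]
    {ι : X.functionField →+* K} (hι : Function.Bijective ι) (hreg : IsRegularScheme X)
    (hdim : topologicalKrullDim X ≤ 2) (x : X) : (locRing ι x).IsSurfaceLike := by
  obtain ⟨hN, n, g, hg, hn⟩ := hreg x
  obtain ⟨hc, u, v, huv⟩ := isIntegrallyClosed_and_exists_span_pair g hg hn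
    ((X.ringKrullDim_stalk_le_topologicalKrullDim x).trans hdim)
  let := (stalkEmb ι x).toAlgebra
  have hfr : IsFractionRing (X.presheaf.stalk x) K := by
    refine (IsLocalization.isLocalization_iff_of_algEquiv (S := X.functionField) _
      (AlgEquiv.ofRingEquiv (f := RingEquiv.ofBijective ι hι) fun a ↦ rfl)).mp
        (inferInstanceAs (IsFractionRing (X.presheaf.stalk x) X.functionField))
  have hval (a : X.presheaf.stalk x) : (stalkEquiv ι x a : K) = algebraMap _ K a := rfl
  refine ⟨isNoetherianRing_of_ringEquiv _ (stalkEquiv ι x), fun c hc' ↦ ?_,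
    ⟨stalkEquiv ι x u, stalkEquiv ι x v, ?_⟩, fun c ↦ ?_⟩
  · have h : _root_.IsIntegral (X.presheaf.stalk x) c := by
      obtain ⟨p, hp, hpc⟩ := hc'
      refine ⟨p.map (stalkEquiv ι x).symm.toRingHom, hp.map _, ?_⟩
      rw [Polynomial.eval₂_map, ← hpc]
      congr 1
      ext a
      obtain ⟨a, rfl⟩ := (stalkEquiv ι x).surjective a
      simp [← hval]
      rfl
    obtain ⟨a, rfl⟩ := IsIntegrallyClosed.algebraMap_eq_of_integral h
    exact (stalkEquiv ι x a).2
  · have := congrArg (Ideal.map (stalkEquiv ι x).toRingHom) huv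
    rw [Ideal.map_span, Set.image_pair] at this
    refine Eq.trans ?_ this
    ext a
    obtain ⟨a, rfl⟩ := (stalkEquiv ι x).surjective a
    rw [IsLocalRing.mem_maximalIdeal, mem_nonunits_iff]
    change ¬ IsUnit (stalkEquiv ι x a) ↔ stalkEquiv ι x a ∈ Ideal.map (stalkEquiv ι x) _
    rw [MulEquiv.isUnit_map, ← Ideal.comap_symm, Ideal.mem_comap]
    simp
  · obtain ⟨a, b, hb, rfl⟩ := IsFractionRing.div_surjective (A := X.presheaf.stalk x) c
    have hb' := nonZeroDivisors.ne_zero hb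
    refine ⟨stalkEquiv ι x a, stalkEquiv ι x b, by simpa using hb', ?_⟩
    rw [hval, hval]
    exact div_mul_cancel₀ _ (by simpa using hb')

/-- A morphism that is an isomorphism over a dense open subset identifies the function fields. -/
theorem exists_genMap_comp_eq {X Y : Scheme.{0}} [IsIntegral X] [IsIntegral Y] (f : X ⟶ Y)
    (hf : ∃ V : Y.Opens, Dense (V : Set Y) ∧ IsIso (f ∣_ V)) :
    ∃ ι : Y.functionField →+* X.functionField, Function.Bijective ι ∧
      genMap (RingHom.id X.functionField) ≫ f = genMap ι := by
  obtain ⟨V, hV, hiso⟩ := hf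
  obtain ⟨y, hy⟩ := hV.nonempty
  have hne : Nonempty V := ⟨⟨y, hy⟩⟩
  have : Nonempty (f ⁻¹ᵁ V) := ⟨(inv (f ∣_ V)) ⟨y, hy⟩⟩
  have hcomm := morphismRestrict_ι f V
  have : IsOpenImmersion ((f ⁻¹ᵁ V).ι ≫ f) := hcomm ▸ inferInstance
  have h₁ := genericPoint_eq_of_isOpenImmersion (f ⁻¹ᵁ V).ι
  have h₂ := genericPoint_eq_of_isOpenImmersion ((f ⁻¹ᵁ V).ι ≫ f)
  have hgen : f (genericPoint X) = genericPoint Y := by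
    rw [← h₁, ← h₂]
    rfl
  have hst : IsIso (f.stalkMap (genericPoint X)) := by
    rw [← h₁]
    generalize genericPoint (f ⁻¹ᵁ V : Scheme.{0}) = p
    have : IsIso (f.stalkMap ((f ⁻¹ᵁ V).ι p) ≫ (f ⁻¹ᵁ V).ι.stalkMap p) := by
      rw [← Scheme.Hom.stalkMap_comp]
      exact inferInstanceAs (IsIso (((f ⁻¹ᵁ V).ι ≫ f).stalkMap p))
    exact IsIso.of_isIso_comp_right _ ((f ⁻¹ᵁ V).ι.stalkMap p)
  have hin : Inseparable (f (genericPoint X)) (genericPoint Y) := .of_eq hgen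
  have hsp : IsIso (Y.presheaf.stalkSpecializes hin.specializes) :=
    (Y.presheaf.stalkCongr hin).symm.isIso_hom
  let e := Y.presheaf.stalkSpecializes hin.specializes ≫ f.stalkMap (genericPoint X)
  refine ⟨e.hom, ConcreteCategory.bijective_of_isIso e, ?_⟩
  have h₃ : Spec.map e ≫ Y.fromSpecStalk (genericPoint Y) =
      X.fromSpecStalk (genericPoint X) ≫ f := by
    rw [Spec.map_comp, Category.assoc, Scheme.SpecMap_stalkSpecializes_fromSpecStalk,
      Scheme.SpecMap_stalkMap_fromSpecStalk]
  have h₄ : genMap (RingHom.id X.functionField) = X.fromSpecStalk (genericPoint X) := by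
    rw [genMap, specMapOf, CommRingCat.ofHom_id, Spec.map_id]
    exact Category.id_comp _
  rw [h₄, ← h₃]
  rfl

/-- The fibers of a proper birational morphism of schemes whose local rings are surface-like are
`𝔸¹`-chain connected. -/
theorem a1Equiv_pullback {X Y : Scheme.{0}} [IsIntegral X] [IsIntegral Y] [X.IsSeparated]
    [Y.IsSeparated] {K : Type} [Field K] {ι : X.functionField →+* K} {ι' : Y.functionField →+* K}
    {f : X ⟶ Y} [IsProper f] (hf : genMap ι ≫ f = genMap ι')
    (hX : ∀ x, (locRing ι x).IsSurfaceLike) (hY : ∀ y, (locRing ι' y).IsSurfaceLike)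
    {F : Type} [Field F] (i : Spec (.of F) ⟶ Y) {M : Type} [Field M] (φ : F →+* M)
    (z₀ z₁ : Spec (.of M) ⟶ pullback f i) (h₀ : z₀ ≫ pullback.snd f i = specMapOf φ)
    (h₁ : z₁ ≫ pullback.snd f i = specMapOf φ) :
    A1Equiv F M φ (pullback f i) (pullback.snd f i) z₀ z₁ := by
  have key := rel_of_isSurfaceLike hf hX hY (specMapOf φ ≫ i)
    (fun w w' ↦ ∃ (h : w ≫ f = specMapOf φ ≫ i) (h' : w' ≫ f = specMapOf φ ≫ i),
      A1Equiv F M φ (pullback f i) (pullback.snd f i)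
        (pullback.lift w (specMapOf φ) h) (pullback.lift w' (specMapOf φ) h'))
    (fun w hw ↦ ⟨hw, hw, .refl _⟩)
    (fun w w' ⟨h, h', e⟩ ↦ ⟨h', h, .symm _ _ e⟩)
    (fun w w' w'' ⟨h, h', e⟩ ⟨_, h'', e'⟩ ↦ ⟨h, h'', .trans _ _ _ e e'⟩)
    (fun l hl ↦ ?_) (z₀ ≫ pullback.fst _ _) (z₁ ≫ pullback.fst _ _)
    (by rw [Category.assoc, pullback.condition, reassoc_of% h₀])
    (by rw [Category.assoc, pullback.condition, reassoc_of% h₁])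
  · obtain ⟨h, h', e⟩ := key
    convert e using 1
    · exact pullback.hom_ext (pullback.lift_fst _ _ _).symm (h₀.trans (pullback.lift_snd _ _ _).symm)
    · exact pullback.hom_ext (pullback.lift_fst _ _ _).symm (h₁.trans (pullback.lift_snd _ _ _).symm)
  · have hC (c : M) : specMapOf (Polynomial.evalRingHom c) ≫ specMapOf Polynomial.C =
        𝟙 (Spec (.of M)) := by
      rw [← specMapOf_comp, ← Spec.map_id]
      refine congrArg (fun g ↦ Spec.map (CommRingCat.ofHom g)) ?_
      ext
      simp
    have hz (c : M) : (specMapOf (Polynomial.evalRingHom c) ≫ l) ≫ f = specMapOf φ ≫ i := by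
      rw [Category.assoc, hl, reassoc_of% hC c]
    have hC' (c : M) : specMapOf (Polynomial.evalRingHom c) ≫ specMapOf (Polynomial.C.comp φ) =
        specMapOf φ := by
      rw [specMapOf_comp, reassoc_of% hC c]
    have hl' : l ≫ f = specMapOf (Polynomial.C.comp φ) ≫ i := by
      rw [hl, specMapOf_comp, Category.assoc]
    have hlift (c : M) : specMapOf (Polynomial.evalRingHom c) ≫ pullback.lift l _ hl' =
        pullback.lift (specMapOf (Polynomial.evalRingHom c) ≫ l) (specMapOf φ) (hz c) := by
      apply pullback.hom_ext
      · rw [Category.assoc, pullback.lift_fst]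
        exact (pullback.lift_fst _ _ _).symm
      · rw [Category.assoc, pullback.lift_snd]
        exact (hC' c).trans (pullback.lift_snd _ _ _).symm
    exact ⟨hz 0, hz 1, .rel _ _ ⟨pullback.lift l (specMapOf (Polynomial.C.comp φ)) hl',
      pullback.lift_snd _ _ _, hlift 0, hlift 1⟩⟩

end Birational

/-- Let `f : S' ⟶ S` be a proper birational `k`-morphism between integral regular separated
finite-type `k`-schemes of Krull dimension `2`.  Then each scheme-theoretic fiber
`S'_s = S' ×_S Spec κ(s)` is an `𝔸¹`-chain connected `κ(s)`-scheme: for every field extension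
`M` of `κ(s)`, any two `M`-points of the fiber are `𝔸¹`-equivalent. -/
theorem fiber_a1ChainConnected_of_proper_birational_regular_surfaces
    (k : Type) [Field k]
    (S' S : Scheme) (sS' : S' ⟶ Spec (CommRingCat.of k)) (sS : S ⟶ Spec (CommRingCat.of k))
    (hS'int : IsIntegral S') (hSint : IsIntegral S)
    (hS'reg : IsRegularScheme S') (hSreg : IsRegularScheme S)
    (hS'sep : IsSeparated sS') (hS'lft : LocallyOfFiniteType sS') (hS'qc : QuasiCompact sS')
    (hSsep : IsSeparated sS) (hSlft : LocallyOfFiniteType sS) (hSqc : QuasiCompact sS)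
    (hS'dim : topologicalKrullDim S' = 2) (hSdim : topologicalKrullDim S = 2)
    (f : S' ⟶ S) (hf : f ≫ sS = sS') (hproper : IsProper f)
    (hbir : ∃ V : S.Opens, Dense (V : Set S) ∧ IsIso (f ∣_ V)) :
    ∀ s : S,
      ∀ (M : Type) [Field M] [Algebra (S.residueField s) M],
        ∀ z₀ z₁ : Spec (CommRingCat.of M) ⟶ pullback f (S.fromSpecResidueField s),
          z₀ ≫ pullback.snd f (S.fromSpecResidueField s) =
            specMapOf (algebraMap (S.residueField s) M) →
          z₁ ≫ pullback.snd f (S.fromSpecResidueField s) =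
            specMapOf (algebraMap (S.residueField s) M) →
          A1Equiv (S.residueField s) M (algebraMap (S.residueField s) M)
            (pullback f (S.fromSpecResidueField s))
            (pullback.snd f (S.fromSpecResidueField s)) z₀ z₁ := by
  intro s M _ _ z₀ z₁ h₀ h₁
  have hsep' : S'.IsSeparated := ⟨by
    rw [← terminal.comp_from sS']
    infer_instance⟩
  have hsep : S.IsSeparated := ⟨by
    rw [← terminal.comp_from sS]
    infer_instance⟩
  obtain ⟨ι, hι, hgen⟩ := exists_genMap_comp_eq f hbir
  exact a1Equiv_pullback hgen (isSurfaceLike_locRing Function.bijective_id hS'reg hS'dim.le)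
    (isSurfaceLike_locRing hι hSreg hSdim.le) (S.fromSpecResidueField s)
    (algebraMap (S.residueField s) M) z₀ z₁ h₀ h₁

end
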